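/- arXiv:2302.04292 — 4 statements merged into one kernel-verified Lean document; each statement's English description precedes it below -/
import Mathlib

section
/- Let α, β > 0 and d ∈ ℕ. There exists a sequence of estimators (V_n)_{n=1}^∞ (each V_n a measurable map from n-tuples of points in [0,1]^d to the set 𝒟_d of pdfs supported on [0,1]^d) that is universally consistent on 𝒟_d — for every fixed sampling density p ∈ 𝒟_d, ‖p − V_n(X_1,…,X_n)‖_1 → 0 in probability as n → ∞ when X_1,…,X_n are i.i.d. with density p — and such that for every fixed sampling density p ∈ 𝒟_d ∩ 𝔙(W, L) with W_k ∈ O(k^{−α}) and L_k ∈ O(k^{β}) as k → ∞, the L¹ error satisfies ‖V_n − p‖_1 ∈ Õ(n^{−α/(3α+β+1)}), i.e., with high probability the error is O(n^{−α/(3α+β+1)}) up to polylogarithmic factors in n. -/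
open MeasureTheory Filter Finset

noncomputable section

/-- A pdf on `ℝ`: a Lebesgue-measurable, a.e. non-negative function with integral one. -/
def IsPdf1 (f : ℝ → ℝ) : Prop :=
  Measurable f ∧ (∀ᵐ x ∂(volume : Measure ℝ), 0 ≤ f x) ∧ ∫ x, f x = 1

/-- Membership in `𝒟_d`: a pdf on `ℝ^d` supported on the unit cube `[0,1]^d`. -/
def MemD (d : ℕ) (p : (Fin d → ℝ) → ℝ) : Prop :=
  Measurable p ∧ (∀ᵐ x ∂(volume : Measure (Fin d → ℝ)), 0 ≤ p x) ∧ (∫ x, p x = 1) ∧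
    ∀ x, x ∉ Set.Icc (0 : Fin d → ℝ) 1 → p x = 0

/-- `p` has NL-spectrum `(w, L)` (sequences `0`-indexed: index `i` is the paper's `i+1`). -/
def HasNLSpectrum (d : ℕ) (p : (Fin d → ℝ) → ℝ) (w L : ℕ → ℝ) : Prop :=
  ∃ q : ℕ → Fin d → ℝ → ℝ,
    (∀ i, 0 ≤ w i) ∧ 0 < w 0 ∧ HasSum w 1 ∧
    (∀ i j, IsPdf1 (q i j) ∧ ∀ x y, |q i j x - q i j y| ≤ L i * |x - y|) ∧
    ∀ᵐ x ∂(volume : Measure (Fin d → ℝ)), p x = ∑' i, w i * ∏ j, q i j (x j)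

/-- Membership in the NL-class `𝔙(W, L̃)` (sequences `0`-indexed). -/
def MemNLClass (d : ℕ) (p : (Fin d → ℝ) → ℝ) (W Lt : ℕ → ℝ) : Prop :=
  ∃ w L : ℕ → ℝ, HasNLSpectrum d p w L ∧
    ∀ k : ℕ, L k ≤ Lt k ∧ (∑' i, w (i + (k + 1))) ≤ W k

/-- The distribution of `n` i.i.d. samples from the density `p`. -/
def sampleMeasure (d n : ℕ) (p : (Fin d → ℝ) → ℝ) :
    Measure (Fin n → Fin d → ℝ) :=
  Measure.pi fun _ : Fin n =>
    (volume : Measure (Fin d → ℝ)).withDensity fun x => ENNReal.ofReal (p x)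

lemma MemD.integrable {d : ℕ} {p : (Fin d → ℝ) → ℝ} (h : MemD d p) : Integrable p := by
  by_contra hn
  have := integral_undef hn
  rw [h.2.2.1] at this
  norm_num at this

def muP (d : ℕ) (p : (Fin d → ℝ) → ℝ) : Measure (Fin d → ℝ) :=
  (volume : Measure (Fin d → ℝ)).withDensity fun x => ENNReal.ofReal (p x)

lemma muP_prob {d : ℕ} {p : (Fin d → ℝ) → ℝ} (h : MemD d p) : IsProbabilityMeasure (muP d p) :=
  ⟨by rw [muP, withDensity_apply _ .univ, setLIntegral_univ,
        ← ofReal_integral_eq_lintegral_ofReal h.integrable h.2.1, h.2.2.1]; simp⟩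

lemma muP_real {d : ℕ} {p : (Fin d → ℝ) → ℝ} (h : MemD d p) {A : Set (Fin d → ℝ)}
    (hA : MeasurableSet A) : (muP d p).real A = ∫ x in A, p x := by
  rw [Measure.real, muP, withDensity_apply _ hA,
    integral_eq_lintegral_of_nonneg_ae (ae_restrict_of_ae h.2.1)
      h.integrable.aestronglyMeasurable.restrict]

open Classical in
def cnt {n : ℕ} {X : Type*} (A : Set X) (xs : Fin n → X) : ℕ := #{i | xs i ∈ A}

lemma cnt_eq {n : ℕ} {X : Type*} (A : Set X) (xs : Fin n → X) :
    (cnt A xs : ℝ) = ∑ i, A.indicator (fun _ => (1 : ℝ)) (xs i) := by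
  classical
  simp only [cnt, Set.indicator_apply, Finset.sum_ite, Finset.sum_const_zero, add_zero,
    Finset.sum_const, nsmul_eq_mul, mul_one]

lemma measurable_cnt {n : ℕ} {X : Type*} [MeasurableSpace X] {A : Set X} (hA : MeasurableSet A) :
    Measurable (fun xs : Fin n → X => cnt A xs) := by
  classical
  have : (fun xs : Fin n → X => cnt A xs) =
      fun xs => ∑ i, A.indicator (fun _ => (1 : ℕ)) (xs i) := by
    funext xs
    simp only [cnt, Set.indicator_apply, Finset.sum_ite, Finset.sum_const_zero, add_zero,
      Finset.sum_const, smul_eq_mul, mul_one]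
  rw [this]
  refine Finset.measurable_sum _ fun i _ => ?_
  exact (measurable_const.indicator hA).comp (measurable_pi_apply i)

lemma hoeff1 {X : Type*} [MeasurableSpace X] (μ : Measure X) [IsProbabilityMeasure μ]
    (g : X → ℝ) (hg : Measurable g) (a : ℝ) (hb : ∀ x, g x ∈ Set.Icc a (a + 1)) (n : ℕ) (hn : 0 < n)
    (t : ℝ) (ht : 0 ≤ t) :
    (Measure.pi fun _ : Fin n => μ) {xs | n * t ≤ ∑ i, (g (xs i) - ∫ x, g x ∂μ)} ≤
      ENNReal.ofReal (Real.exp (-2 * n * t ^ 2)) := by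
  have hind := ProbabilityTheory.iIndepFun_pi (μ := fun _ : Fin n => μ)
    (X := fun _ x => g x - ∫ x, g x ∂μ) (fun i => (hg.sub_const _).aemeasurable)
  have hsub : ∀ i ∈ (univ : Finset (Fin n)),
      ProbabilityTheory.HasSubgaussianMGF (fun xs : Fin n → X => g (xs i) - ∫ x, g x ∂μ)
        ((‖(a + 1) - a‖₊ / 2) ^ 2) (Measure.pi fun _ : Fin n => μ) := by
    intro i _
    have h := ProbabilityTheory.hasSubgaussianMGF_of_mem_Icc
      (μ := (Measure.pi fun _ : Fin n => μ)) (X := fun xs : Fin n → X => g (xs i))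
      (a := a) (b := a + 1)
      (hg.comp (measurable_pi_apply i)).aemeasurable (Eventually.of_forall fun xs => hb _)
    have he : ∫ xs : Fin n → X, g (xs i) ∂(Measure.pi fun _ : Fin n => μ) = ∫ x, g x ∂μ := by
      have := (measurePreserving_eval (fun _ : Fin n => μ) i).map_eq
      conv_rhs => rw [← this]
      rw [integral_map (measurable_pi_apply i).aemeasurable hg.aestronglyMeasurable]
    rw [he] at h
    exact h
  have := ProbabilityTheory.HasSubgaussianMGF.measure_sum_ge_le_of_iIndepFun hind hsub
    (ε := n * t) (by positivity)
  rw [← ENNReal.ofReal_toReal (measure_ne_top (Measure.pi fun _ : Fin n => μ) _)]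
  apply ENNReal.ofReal_le_ofReal
  refine this.trans (le_of_eq ?_)
  have hn' : (n : ℝ) ≠ 0 := by positivity
  congr 1
  simp
  field_simp

lemma hoeff {X : Type*} [MeasurableSpace X] (μ : Measure X) [IsProbabilityMeasure μ]
    (A : Set X) (hA : MeasurableSet A) (n : ℕ) (hn : 0 < n) (t : ℝ) (ht : 0 ≤ t) :
    (Measure.pi fun _ : Fin n => μ) {xs | t ≤ |(cnt A xs : ℝ) / n - μ.real A|} ≤
      ENNReal.ofReal (2 * Real.exp (-2 * n * t ^ 2)) := by
  have hn' : (0 : ℝ) < n := by positivity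
  have hm : Measurable (A.indicator (fun _ => (1 : ℝ))) := measurable_const.indicator hA
  have hi : ∫ x, A.indicator (fun _ => (1 : ℝ)) x ∂μ = μ.real A := by
    rw [integral_indicator hA]; simp
  have h1 := hoeff1 μ (A.indicator (fun _ => (1 : ℝ))) hm 0
    (fun x => by by_cases h : x ∈ A <;> simp [h]) n hn t ht
  have h2 := hoeff1 μ (fun x => - A.indicator (fun _ => (1 : ℝ)) x) hm.neg (-1)
    (fun x => by by_cases h : x ∈ A <;> simp [h]) n hn t ht
  have hsub : {xs : Fin n → X | t ≤ |(cnt A xs : ℝ) / n - μ.real A|} ⊆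
      {xs | n * t ≤ ∑ i, (A.indicator (fun _ => (1 : ℝ)) (xs i) -
        ∫ x, A.indicator (fun _ => (1 : ℝ)) x ∂μ)} ∪
      {xs | n * t ≤ ∑ i, (- A.indicator (fun _ => (1 : ℝ)) (xs i) -
        ∫ x, - A.indicator (fun _ => (1 : ℝ)) x ∂μ)} := by
    intro xs hxs
    simp only [Set.mem_ofPred_eq, Set.mem_union, integral_neg, hi, Finset.sum_sub_distrib,
      Finset.sum_neg_distrib, ← cnt_eq] at hxs ⊢
    simp only [Finset.sum_const, Finset.card_univ, Fintype.card_fin, nsmul_eq_mul]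
    have e : (cnt A xs : ℝ) = n * ((cnt A xs : ℝ) / n) := by field_simp
    rcases le_abs.1 hxs with h | h
    · left; rw [e, ← mul_sub]; exact mul_le_mul_of_nonneg_left h hn'.le
    · right
      have := mul_le_mul_of_nonneg_left h hn'.le
      rw [neg_sub, mul_sub, ← e] at this
      linarith
  refine (measure_mono hsub).trans ((measure_union_le _ _).trans ((add_le_add h1 h2).trans ?_))
  rw [← ENNReal.ofReal_add (by positivity) (by positivity)]
  apply ENNReal.ofReal_le_ofReal
  linarith

lemma scheffe {X : Type*} [MeasurableSpace X] {μ : Measure X} {f g : X → ℝ}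
    (hf : Integrable f μ) (hg : Integrable g μ) (hfm : Measurable f) (hgm : Measurable g)
    (h : ∫ x, f x ∂μ = ∫ x, g x ∂μ) :
    ∫ x, |f x - g x| ∂μ = 2 * ((∫ x in {x | g x < f x}, f x ∂μ) - ∫ x in {x | g x < f x}, g x ∂μ) := by
  have hA : MeasurableSet {x | g x < f x} := measurableSet_lt hgm hfm
  have e : ∀ x, |f x - g x| = 2 * ({x | g x < f x}.indicator (fun x => f x - g x) x) - (f x - g x) := by
    intro x
    by_cases hx : g x < f x
    · rw [Set.indicator_of_mem (by exact hx), abs_of_pos (by linarith)]; ring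
    · rw [Set.indicator_of_notMem (by exact hx), abs_of_nonpos (by linarith)]; ring
  simp_rw [e]
  have hi : Integrable (fun x => f x - g x) μ := hf.sub hg
  rw [integral_sub ((hi.indicator hA).const_mul 2) hi, integral_const_mul, integral_indicator hA,
    integral_sub hf hg, integral_sub hf.integrableOn hg.integrableOn, h]
  ring

lemma abs_setInt_le {X : Type*} [MeasurableSpace X] {μ : Measure X} {f g : X → ℝ}
    (hf : Integrable f μ) (hg : Integrable g μ) (A : Set X) :
    |(∫ x in A, f x ∂μ) - ∫ x in A, g x ∂μ| ≤ ∫ x, |f x - g x| ∂μ := by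
  rw [← integral_sub hf.integrableOn hg.integrableOn]
  refine abs_integral_le_integral_abs.trans ?_
  exact setIntegral_le_integral (hf.sub hg).abs (Eventually.of_forall fun x => abs_nonneg _)

lemma l1_tri {X : Type*} [MeasurableSpace X] {μ : Measure X} {f g h : X → ℝ}
    (hf : Integrable f μ) (hg : Integrable g μ) (hh : Integrable h μ) :
    ∫ x, |f x - h x| ∂μ ≤ (∫ x, |f x - g x| ∂μ) + ∫ x, |g x - h x| ∂μ := by
  have h1 : Integrable (fun x => |f x - g x|) μ := (hf.sub hg).abs
  have h2 : Integrable (fun x => |g x - h x|) μ := (hg.sub hh).abs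
  have h3 : Integrable (fun x => |f x - h x|) μ := (hf.sub hh).abs
  rw [← integral_add h1 h2]
  exact integral_mono h3 (h1.add h2) fun x => abs_sub_le _ _ _

/-- the minimum distance estimator -/
theorem mde {d n : ℕ} (hn : 0 < n) {Θ : Type} [Fintype Θ] [Nonempty Θ] [MeasurableSpace Θ]
    (f : Θ → (Fin d → ℝ) → ℝ) (hf : ∀ θ, MemD d (f θ)) :
    ∃ T : (Fin n → Fin d → ℝ) → Θ, Measurable T ∧
      ∀ p, MemD d p → ∀ θ t, 0 ≤ t →
        sampleMeasure d n p {xs | 5 * (∫ x, |p x - f θ x|) + 4 * t < ∫ x, |p x - f (T xs) x|} ≤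
          ENNReal.ofReal ((Fintype.card Θ : ℝ) ^ 2 * (2 * Real.exp (-2 * n * t ^ 2))) := by
  classical
  let A : Θ × Θ → Set (Fin d → ℝ) := fun a => {x | f a.2 x < f a.1 x}
  have hA : ∀ a, MeasurableSet (A a) := fun a => measurableSet_lt (hf _).1 (hf _).1
  let Δ : (Θ × Θ → ℕ) → Θ → ℝ := fun c θ => ⨆ a, |(∫ x in A a, f θ x) - (c a : ℝ) / n|
  have hmin : ∀ c, ∃ θ, ∀ θ', Δ c θ ≤ Δ c θ' := fun c => Finite.exists_min (Δ c)
  choose Φ hΦ using hmin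
  refine ⟨fun xs => Φ (fun a => cnt (A a) xs), ?_, ?_⟩
  · have : Measurable Φ := measurable_of_countable _
    exact this.comp (measurable_pi_lambda _ fun a => measurable_cnt (hA a))
  · intro p hp θ t ht
    have := muP_prob hp
    have hle : ∀ c θ a, |(∫ x in A a, f θ x) - (c a : ℝ) / n| ≤ Δ c θ := fun c θ a =>
      le_ciSup (f := fun a => |(∫ x in A a, f θ x) - (c a : ℝ) / n|) (Set.finite_range _).bddAbove a
    have hsub : {xs : Fin n → Fin d → ℝ | 5 * (∫ x, |p x - f θ x|) + 4 * t <
        ∫ x, |p x - f (Φ (fun a => cnt (A a) xs)) x|} ⊆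
        ⋃ a : Θ × Θ, {xs | t ≤ |(cnt (A a) xs : ℝ) / n - (muP d p).real (A a)|} := by
      intro xs hxs
      by_contra hcon
      simp only [Set.mem_iUnion, Set.mem_ofPred_eq, not_exists, not_le] at hcon hxs
      set c : Θ × Θ → ℕ := fun a => cnt (A a) xs with hc
      set η := ∫ x, |p x - f θ x| with hη
      have h1 : Δ c θ ≤ η + t := by
        refine ciSup_le fun a => ?_
        have h2 := abs_setInt_le hp.integrable (hf θ).integrable (A a)
        have h3 := hcon a
        rw [muP_real hp (hA a)] at h3
        have h4 : (∫ x in A a, f θ x) - (c a : ℝ) / n =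
          -((∫ x in A a, p x) - (∫ x in A a, f θ x)) - ((cnt (A a) xs : ℝ) / n - ∫ x in A a, p x) := by
          simp only [hc]; ring
        rw [h4]
        refine (abs_sub _ _).trans ?_
        rw [abs_neg]
        linarith
      have h2 : Δ c (Φ c) ≤ η + t := (hΦ c θ).trans h1
      have h3 : ∫ x, |f θ x - f (Φ c) x| ≤ 4 * (η + t) := by
        rw [scheffe (hf _).integrable (hf _).integrable (hf _).1 (hf _).1
          ((hf _).2.2.1.trans (hf _).2.2.1.symm)]
        have h4 := abs_le.1 ((hle c θ (θ, Φ c)).trans h1)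
        have h5 := abs_le.1 ((hle c (Φ c) (θ, Φ c)).trans h2)
        have h6 : A (θ, Φ c) = {x | f (Φ c) x < f θ x} := rfl
        rw [← h6]
        linarith [h4.1, h4.2, h5.1, h5.2]
      have h7 : ∫ x, |p x - f (Φ c) x| ≤ η + ∫ x, |f θ x - f (Φ c) x| := by
        exact l1_tri hp.integrable (hf _).integrable (hf _).integrable
      linarith
    refine (measure_mono hsub).trans ((measure_iUnion_fintype_le _ _).trans ?_)
    refine (Finset.sum_le_sum fun a _ => hoeff (muP d p) (A a) (hA a) n hn t ht).trans ?_
    rw [Finset.sum_const, Finset.card_univ, Fintype.card_prod, nsmul_eq_mul,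
      ← ENNReal.ofReal_natCast, ← ENNReal.ofReal_mul (by positivity)]
    apply le_of_eq
    congr 1
    push_cast
    ring

/-- one-dimensional step function on `[0,1]` with values in `{0, 1/n, ...}` -/
def stepF (b n : ℕ) (a : Fin (b + 1) → Fin (n ^ 2 + 1)) : ℝ → ℝ :=
  (Set.Icc (0 : ℝ) 1).indicator fun t => ((a (Fin.ofNat (b + 1) ⌊t * b⌋₊) : ℕ) : ℝ) / n

lemma stepF_nonneg (b n : ℕ) (a) (t : ℝ) : 0 ≤ stepF b n a t :=
  Set.indicator_nonneg (fun _ _ => by positivity) _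

lemma stepF_meas (b n : ℕ) (a) : Measurable (stepF b n a) := by
  refine Measurable.indicator ?_ measurableSet_Icc
  have h1 : Measurable (fun t : ℝ => ⌊t * (b : ℝ)⌋₊) := Nat.measurable_floor.comp (measurable_id.mul_const _)
  have h2 : Measurable (fun m : ℕ => ((a (Fin.ofNat (b + 1) m) : ℕ) : ℝ) / n) := measurable_of_countable _
  exact h2.comp h1

lemma stepF_int (b n : ℕ) (a) : Integrable (stepF b n a) := by
  refine (integrable_indicator_iff measurableSet_Icc).2 ?_
  have : IntegrableOn (stepF b n a) (Set.Icc 0 1) := by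
    refine Measure.integrableOn_of_bounded (M := n ^ 2 + 1) (by simp) (stepF_meas b n a).aestronglyMeasurable ?_
    refine Eventually.of_forall fun t => ?_
    rw [Real.norm_of_nonneg (stepF_nonneg _ _ _ _), stepF]
    by_cases ht : t ∈ Set.Icc (0 : ℝ) 1
    swap
    · rw [Set.indicator_of_notMem ht]; positivity
    rw [Set.indicator_of_mem ht]
    have h1 : (((a (Fin.ofNat (b + 1) ⌊t * b⌋₊)) : ℕ) : ℝ) ≤ n ^ 2 + 1 := by
      exact_mod_cast (a (Fin.ofNat (b + 1) ⌊t * b⌋₊)).2.le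
    rcases Nat.eq_zero_or_pos n with h | h
    · subst h; simp
    · have h2 : (1 : ℝ) ≤ n := by exact_mod_cast h
      exact (div_le_self (by positivity) h2).trans h1
  refine this.congr_fun ?_ measurableSet_Icc
  intro t ht
  simp [stepF, ht]

abbrev Par (d k b n : ℕ) : Type :=
  (Fin k → Fin (n ^ 2 + 1)) × (Fin k → Fin d → Fin (b + 1) → Fin (n ^ 2 + 1))

/-- unnormalised candidate -/
def gF {d k b n : ℕ} (θ : Par d k b n) (x : Fin d → ℝ) : ℝ :=
  ∑ i, (((θ.1 i : ℕ) : ℝ) / n) * ∏ j, stepF b n (θ.2 i j) (x j)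

lemma gF_nonneg {d k b n : ℕ} (θ : Par d k b n) (x : Fin d → ℝ) : 0 ≤ gF θ x :=
  Finset.sum_nonneg fun i _ => mul_nonneg (by positivity)
    (Finset.prod_nonneg fun j _ => stepF_nonneg _ _ _ _)

lemma gF_meas {d k b n : ℕ} (θ : Par d k b n) : Measurable (gF θ) :=
  Finset.measurable_sum _ fun i _ => Measurable.const_mul
    (Finset.measurable_prod _ fun j _ => (stepF_meas _ _ _).comp (measurable_pi_apply j)) _

lemma gF_int {d k b n : ℕ} (θ : Par d k b n) : Integrable (gF θ) :=
  integrable_finsetSum _ fun i _ => (Integrable.fintype_prod (f := fun j => stepF b n (θ.2 i j))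
    fun j => stepF_int _ _ _).const_mul _

lemma notMem_cube {d : ℕ} {x : Fin d → ℝ} (hx : x ∉ Set.Icc (0 : Fin d → ℝ) 1) :
    ∃ j, x j ∉ Set.Icc (0 : ℝ) 1 := by
  by_contra h
  push Not at h
  exact hx ⟨fun j => (h j).1, fun j => (h j).2⟩

lemma gF_zero {d k b n : ℕ} (θ : Par d k b n) (x : Fin d → ℝ)
    (hx : x ∉ Set.Icc (0 : Fin d → ℝ) 1) : gF θ x = 0 := by
  obtain ⟨j, hj⟩ := notMem_cube hx
  refine Finset.sum_eq_zero fun i _ => ?_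
  rw [Finset.prod_eq_zero (Finset.mem_univ j), mul_zero]
  exact Set.indicator_of_notMem hj _

def unif (d : ℕ) : (Fin d → ℝ) → ℝ := (Set.Icc (0 : Fin d → ℝ) 1).indicator fun _ => 1

lemma unif_memD (d : ℕ) : MemD d (unif d) := by
  refine ⟨measurable_const.indicator measurableSet_Icc,
    Eventually.of_forall fun x => Set.indicator_nonneg (fun _ _ => zero_le_one) _, ?_,
    fun x hx => Set.indicator_of_notMem hx _⟩
  rw [unif, integral_indicator measurableSet_Icc]
  simp [Measure.real, Real.volume_Icc_pi]

/-- normalised candidate -/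
def fF {d k b n : ℕ} (θ : Par d k b n) : (Fin d → ℝ) → ℝ :=
  open Classical in
  if ∫ x, gF θ x = 0 then unif d else fun x => gF θ x / ∫ y, gF θ y

lemma fF_memD {d k b n : ℕ} (θ : Par d k b n) : MemD d (fF θ) := by
  unfold fF
  split_ifs with h
  · exact unif_memD d
  · have hpos : 0 ≤ ∫ y, gF θ y := integral_nonneg (gF_nonneg θ)
    refine ⟨(gF_meas θ).div_const _, Eventually.of_forall fun x => div_nonneg (gF_nonneg θ x) hpos,
      ?_, fun x hx => by simp only [gF_zero θ x hx, zero_div]⟩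
    rw [integral_div, div_self h]

lemma fF_close {d k b n : ℕ} (θ : Par d k b n) {p : (Fin d → ℝ) → ℝ} (hp : MemD d p) :
    ∫ x, |p x - fF θ x| ≤ 2 * ∫ x, |p x - gF θ x| := by
  have hpos : 0 ≤ ∫ y, gF θ y := integral_nonneg (gF_nonneg θ)
  by_cases h : ∫ x, gF θ x = 0
  · have h1 : (1 : ℝ) ≤ ∫ x, |p x - gF θ x| := by
      have := integral_mono (hp.integrable.sub (gF_int θ)) (hp.integrable.sub (gF_int θ)).abs
        (fun x => le_abs_self _)
      rw [show (∫ x, (p - gF θ) x) = ∫ x, (p x - gF θ x) from rfl,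
        integral_sub hp.integrable (gF_int θ), hp.2.2.1, h] at this
      simpa using this
    have h2 : ∫ x, |p x - fF θ x| ≤ 2 := by
      have h3 := l1_tri hp.integrable (integrable_zero _ _ volume) (fF_memD θ).integrable
      simp only [Pi.zero_apply] at h3
      have h4 : ∫ x, |p x - (0 : ℝ)| = 1 := by
        rw [← hp.2.2.1]
        refine integral_congr_ae ?_
        filter_upwards [hp.2.1] with x hx
        rw [sub_zero, abs_of_nonneg hx]
      have h5 : ∫ x, |(0 : ℝ) - fF θ x| = 1 := by
        rw [← (fF_memD θ).2.2.1]
        refine integral_congr_ae ?_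
        filter_upwards [(fF_memD θ).2.1] with x hx
        rw [zero_sub, abs_neg, abs_of_nonneg hx]
      linarith
    linarith
  · have h3 := l1_tri hp.integrable (gF_int θ) (fF_memD θ).integrable
    have h4 : ∫ x, |gF θ x - fF θ x| ≤ ∫ x, |p x - gF θ x| := by
      have e : ∀ x, |gF θ x - fF θ x| = gF θ x * |1 - (∫ y, gF θ y)⁻¹| := by
        intro x
        simp only [fF, h, if_false]
        have e1 : gF θ x - gF θ x / (∫ y, gF θ y) = gF θ x * (1 - (∫ y, gF θ y)⁻¹) := by
          rw [div_eq_mul_inv]; ring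
        rw [e1, abs_mul, abs_of_nonneg (gF_nonneg θ x)]
      simp_rw [e]
      rw [integral_mul_const]
      have h5 : (∫ y, gF θ y) * |1 - (∫ y, gF θ y)⁻¹| = |1 - ∫ y, gF θ y| := by
        conv_lhs => enter [1]; rw [← abs_of_nonneg hpos]
        rw [← abs_mul, mul_sub, mul_inv_cancel₀ h, mul_one, abs_sub_comm]
      rw [h5]
      have h6 := abs_setInt_le hp.integrable (gF_int θ) Set.univ
      simpa [hp.2.2.1] using h6
    linarith

lemma step_approx (b n : ℕ) (hb : 0 < b) (hn : 0 < n) (L : ℝ) (hL : 0 ≤ L) (q : ℝ → ℝ)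
    (hq0 : ∀ t, 0 ≤ q t) (hqn : ∀ t ∈ Set.Icc (0 : ℝ) 1, q t ≤ n)
    (hqL : ∀ s t, |q s - q t| ≤ L * |s - t|) :
    ∃ a, ∀ t ∈ Set.Icc (0 : ℝ) 1, stepF b n a t ≤ q t ∧ q t - stepF b n a t ≤ 2 * L / b + 1 / n := by
  have hb' : (0 : ℝ) < b := by positivity
  have hn' : (0 : ℝ) < n := by positivity
  have hlt : ∀ c : Fin (b + 1), ⌊(n : ℝ) * (q ((c : ℕ) / (b : ℝ)) - L / b)⌋₊ < n ^ 2 + 1 := by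
    intro c
    rw [Nat.lt_succ_iff]
    have h1 : q ((c : ℕ) / (b : ℝ)) ≤ n := by
      refine hqn _ ⟨by positivity, (div_le_one hb').2 ?_⟩
      exact_mod_cast Nat.lt_succ_iff.1 c.2
    have h2 : 0 ≤ L / b := by positivity
    refine Nat.floor_le_of_le ?_
    push_cast
    rw [sq]
    exact mul_le_mul_of_nonneg_left (by linarith) hn'.le
  refine ⟨fun c => ⟨_, hlt c⟩, fun t ht => ?_⟩
  have hc : ((Fin.ofNat (b + 1) ⌊t * b⌋₊ : Fin (b + 1)) : ℕ) = ⌊t * b⌋₊ := by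
    simp only [Fin.ofNat]
    apply Nat.mod_eq_of_lt
    rw [Nat.lt_succ_iff]
    refine Nat.floor_le_of_le ?_
    nlinarith [ht.2]
  simp only [stepF, Set.indicator_of_mem ht, hc]
  set c := ⌊t * b⌋₊ with hcdef
  have h1 : (c : ℝ) ≤ t * b := Nat.floor_le (mul_nonneg ht.1 hb'.le)
  have h2 : t * b < c + 1 := Nat.lt_floor_add_one _
  have h3 : |t - (c : ℝ) / b| ≤ 1 / b := by
    have : t - (c : ℝ) / b = (t * b - c) / b := by field_simp
    rw [this, abs_of_nonneg (div_nonneg (by linarith) hb'.le)]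
    exact div_le_div_of_nonneg_right (by linarith) hb'.le
  have h4 : |q t - q ((c : ℝ) / b)| ≤ L / b := by
    refine (hqL _ _).trans ?_
    rw [div_eq_mul_one_div L]
    exact mul_le_mul_of_nonneg_left h3 hL
  have h5 := abs_le.1 h4
  have h6 : 2 * L / b = L / b + L / b := by ring
  set v := q ((c : ℝ) / b) - L / b with hv
  constructor
  · rw [div_le_iff₀ hn']
    rcases le_or_gt 0 v with h | h
    · refine (Nat.floor_le (by positivity)).trans ?_
      nlinarith [h5.1]
    · rw [Nat.floor_of_nonpos (by nlinarith)]
      have := hq0 t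
      simp only [Nat.cast_zero]
      positivity
  · have h7 := Nat.lt_floor_add_one ((n : ℝ) * v)
    have h8 : v ≤ (⌊(n : ℝ) * v⌋₊ : ℝ) / n + 1 / n := by
      rw [← add_div, le_div_iff₀ hn']
      linarith
    linarith [h5.2]

lemma prod_sub_prod_le {d : ℕ} (Q H : Fin d → ℝ) (η : ℝ) (hη : 0 ≤ η) (h0 : ∀ j, 0 ≤ H j)
    (h1 : ∀ j, H j ≤ Q j) (h2 : ∀ j, Q j ≤ 1) (h3 : ∀ j, Q j - H j ≤ η) :
    ∏ j, Q j - ∏ j, H j ≤ d * η := by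
  induction d with
  | zero => simp
  | succ d ih =>
    rw [Fin.prod_univ_succ, Fin.prod_univ_succ]
    have := ih (fun j => Q j.succ) (fun j => H j.succ) (fun j => h0 _) (fun j => h1 _)
      (fun j => h2 _) (fun j => h3 _)
    have hP0 : 0 ≤ ∏ j : Fin d, H j.succ := Finset.prod_nonneg fun j _ => h0 _
    have hP1 : ∏ j : Fin d, H j.succ ≤ 1 :=
      Finset.prod_le_one (fun j _ => h0 _) fun j _ => (h1 _).trans (h2 _)
    have hQ0 : 0 ≤ Q 0 := (h0 0).trans (h1 0)
    have hPQ : ∏ j : Fin d, H j.succ ≤ ∏ j : Fin d, Q j.succ :=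
      Finset.prod_le_prod (fun j _ => h0 _) fun j _ => h1 _
    push_cast
    have a1 : Q 0 * (∏ j : Fin d, Q j.succ - ∏ j : Fin d, H j.succ) ≤ d * η :=
      (mul_le_of_le_one_left (by linarith) (h2 0)).trans this
    have a2 : (Q 0 - H 0) * ∏ j : Fin d, H j.succ ≤ η :=
      (mul_le_of_le_one_right (by linarith [h1 0]) hP1).trans (h3 0)
    nlinarith

def cutF (q : ℝ → ℝ) : ℝ → ℝ := (Set.Icc (0 : ℝ) 1).indicator q

lemma class_approx {d k b n : ℕ} (hb : 0 < b) (hn : 0 < n) (L : ℝ) (hL : 0 ≤ L)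
    (w : Fin k → ℝ) (hw0 : ∀ i, 0 ≤ w i) (hwn : ∀ i, w i ≤ n)
    (q : Fin k → Fin d → ℝ → ℝ) (hq0 : ∀ i j t, 0 ≤ q i j t)
    (hqn : ∀ i j, ∀ t ∈ Set.Icc (0 : ℝ) 1, q i j t ≤ n)
    (hqL : ∀ i j s t, |q i j s - q i j t| ≤ L * |s - t|)
    (hq1 : ∀ i j, ∫ t, cutF (q i j) t ≤ 1) :
    ∃ θ : Par d k b n, ∫ x, |(∑ i, w i * ∏ j, cutF (q i j) (x j)) - gF θ x| ≤
      (∑ i, w i) * (d * (2 * L / b + 1 / n)) + k / n := by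
  have hn' : (0 : ℝ) < n := by positivity
  have hb' : (0 : ℝ) < b := by positivity
  choose a ha using fun i j => step_approx b n hb hn L hL (q i j) (hq0 i j) (hqn i j) (hqL i j)
  have hlt : ∀ i, ⌊(n : ℝ) * w i⌋₊ < n ^ 2 + 1 := by
    intro i
    rw [Nat.lt_succ_iff]
    refine Nat.floor_le_of_le ?_
    push_cast
    rw [sq]
    exact mul_le_mul_of_nonneg_left (hwn i) hn'.le
  let θ : Par d k b n := (fun i => ⟨_, hlt i⟩, a)
  have hcont : ∀ i j, Continuous (q i j) := fun i j => by
    refine LipschitzWith.continuous (K := ⟨L, hL⟩) (LipschitzWith.of_dist_le_mul fun s t => ?_)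
    exact hqL i j s t
  have hcint : ∀ i j, Integrable (cutF (q i j)) := fun i j =>
    (integrable_indicator_iff measurableSet_Icc).2 ((hcont i j).integrableOn_Icc)
  have hle : ∀ i j t, stepF b n (a i j) t ≤ cutF (q i j) t := by
    intro i j t
    by_cases ht : t ∈ Set.Icc (0 : ℝ) 1
    · rw [cutF, Set.indicator_of_mem ht]; exact (ha i j t ht).1
    · rw [cutF, stepF, Set.indicator_of_notMem ht, Set.indicator_of_notMem ht]
  set η := 2 * L / b + 1 / n with hη
  have hη0 : 0 ≤ η := by positivity
  have hdiff : ∀ i j, (∫ t, cutF (q i j) t) - ∫ t, stepF b n (a i j) t ≤ η := by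
    intro i j
    rw [← integral_sub (hcint i j) (stepF_int _ _ _)]
    have : ∫ t, (Set.Icc (0 : ℝ) 1).indicator (fun _ => η) t = η := by
      rw [integral_indicator measurableSet_Icc]; simp
    rw [← this]
    refine integral_mono ((hcint i j).sub (stepF_int _ _ _))
      ((integrable_indicator_iff measurableSet_Icc).2 (by simp)) fun t => ?_
    by_cases ht : t ∈ Set.Icc (0 : ℝ) 1
    · simp only [cutF, Set.indicator_of_mem ht]; exact (ha i j t ht).2
    · simp only [cutF, stepF, Set.indicator_of_notMem ht]; simp
  have hu : ∀ i, (⌊(n : ℝ) * w i⌋₊ : ℝ) / n ≤ w i := fun i => by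
    rw [div_le_iff₀ hn', mul_comm (w i)]
    exact Nat.floor_le (mul_nonneg hn'.le (hw0 i))
  have hu' : ∀ i, w i - (⌊(n : ℝ) * w i⌋₊ : ℝ) / n ≤ 1 / n := fun i => by
    have h7 := Nat.lt_floor_add_one ((n : ℝ) * w i)
    rw [sub_le_iff_le_add, ← add_div, le_div_iff₀ hn']
    linarith
  refine ⟨θ, ?_⟩
  have hs0 : ∀ i (x : Fin d → ℝ), 0 ≤ ∏ j, stepF b n (a i j) (x j) := fun i x =>
    Finset.prod_nonneg fun j _ => stepF_nonneg _ _ _ _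
  have hpt : ∀ x : Fin d → ℝ, |(∑ i, w i * ∏ j, cutF (q i j) (x j)) - gF θ x| =
      ∑ i, (w i * (∏ j, cutF (q i j) (x j)) -
        (⌊(n : ℝ) * w i⌋₊ : ℝ) / n * ∏ j, stepF b n (a i j) (x j)) := by
    intro x
    rw [gF, ← Finset.sum_sub_distrib, abs_of_nonneg]
    refine Finset.sum_nonneg fun i _ => sub_nonneg.2 ?_
    exact mul_le_mul (hu i) (Finset.prod_le_prod (fun j _ => stepF_nonneg _ _ _ _)
      fun j _ => hle i j _) (hs0 i x) (hw0 i)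
  simp_rw [hpt]
  have hI1 : ∀ i, Integrable (fun x : Fin d → ℝ => w i * ∏ j, cutF (q i j) (x j)) := fun i =>
    (Integrable.fintype_prod (f := fun j => cutF (q i j)) fun j => hcint i j).const_mul _
  have hI2 : ∀ i, Integrable (fun x : Fin d → ℝ =>
      (⌊(n : ℝ) * w i⌋₊ : ℝ) / n * ∏ j, stepF b n (a i j) (x j)) := fun i =>
    (Integrable.fintype_prod (f := fun j => stepF b n (a i j)) fun j => stepF_int _ _ _).const_mul _
  have hI3 : ∀ i, Integrable (fun x : Fin d → ℝ => w i * (∏ j, cutF (q i j) (x j)) -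
        (⌊(n : ℝ) * w i⌋₊ : ℝ) / n * ∏ j, stepF b n (a i j) (x j)) := fun i => (hI1 i).sub (hI2 i)
  rw [integral_finsetSum _ fun i _ => hI3 i]
  have hterm : ∀ i, ∫ x : Fin d → ℝ, (w i * (∏ j, cutF (q i j) (x j)) -
        (⌊(n : ℝ) * w i⌋₊ : ℝ) / n * ∏ j, stepF b n (a i j) (x j)) ≤ w i * (d * η) + 1 / n := by
    intro i
    rw [integral_sub (hI1 i) (hI2 i), integral_const_mul, integral_const_mul,
      integral_fintype_prod_volume_eq_prod (fun j => cutF (q i j)),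
      integral_fintype_prod_volume_eq_prod (fun j => stepF b n (a i j))]
    have hH0 : ∀ j, 0 ≤ ∫ t, stepF b n (a i j) t := fun j => integral_nonneg (stepF_nonneg _ _ _)
    have hHQ : ∀ j, ∫ t, stepF b n (a i j) t ≤ ∫ t, cutF (q i j) t := fun j =>
      integral_mono (stepF_int _ _ _) (hcint i j) (hle i j)
    have h1 := prod_sub_prod_le (fun j => ∫ t, cutF (q i j) t) (fun j => ∫ t, stepF b n (a i j) t)
      η hη0 hH0 hHQ (hq1 i) (hdiff i)
    have h2 : 0 ≤ ∏ j, ∫ t, stepF b n (a i j) t := Finset.prod_nonneg fun j _ => hH0 j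
    have h3 : ∏ j, ∫ t, stepF b n (a i j) t ≤ 1 :=
      Finset.prod_le_one (fun j _ => hH0 j) fun j _ => (hHQ j).trans (hq1 i j)
    have h4 := mul_le_mul_of_nonneg_left h1 (hw0 i)
    have h5 : (w i - (⌊(n : ℝ) * w i⌋₊ : ℝ) / n) * ∏ j, ∫ t, stepF b n (a i j) t ≤ 1 / n :=
      (mul_le_of_le_one_right (by linarith [hu i]) h3).trans (hu' i)
    nlinarith
  refine (Finset.sum_le_sum fun i _ => hterm i).trans (le_of_eq ?_)
  rw [Finset.sum_add_distrib, ← Finset.sum_mul]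
  simp
  ring

lemma lip_cont {L : ℝ} {q : ℝ → ℝ} (hqL : ∀ s t, |q s - q t| ≤ L * |s - t|) : Continuous q := by
  have hL : 0 ≤ L := by
    have h := hqL 0 1
    have := abs_nonneg (q 0 - q 1)
    norm_num at h
    linarith
  refine LipschitzWith.continuous (K := ⟨L, hL⟩) (LipschitzWith.of_dist_le_mul fun s t => ?_)
  exact hqL s t

lemma pdf_facts {L : ℝ} {q : ℝ → ℝ} (hq : IsPdf1 q) (hqL : ∀ s t, |q s - q t| ≤ L * |s - t|) :
    Integrable q ∧ (∀ t, 0 ≤ q t) ∧ (∀ t, q t ≤ 1 + L) ∧ ∫ t, cutF q t ≤ 1 := by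
  have hL : 0 ≤ L := by
    have h := hqL 0 1
    have := abs_nonneg (q 0 - q 1)
    norm_num at h
    linarith
  have hc := lip_cont hqL
  have hint : Integrable q := by
    by_contra hn
    have := integral_undef hn
    rw [hq.2.2] at this
    norm_num at this
  have h0 : ∀ t, 0 ≤ q t := by
    have hd : Dense {t | 0 ≤ q t} := Measure.dense_of_ae hq.2.1
    have hcl : IsClosed {t | 0 ≤ q t} := isClosed_le continuous_const hc
    intro t
    have := hd t
    rwa [hcl.closure_eq] at this
  refine ⟨hint, h0, fun t => ?_, ?_⟩
  · have h1 : ∫ s in Set.Icc t (t + 1), q s ≤ 1 := by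
      rw [← hq.2.2]
      exact setIntegral_le_integral hint (Eventually.of_forall h0)
    have h2 : ∫ _ in Set.Icc t (t + 1), (q t - L) ≤ ∫ s in Set.Icc t (t + 1), q s := by
      refine setIntegral_mono_on (by simp) hint.integrableOn measurableSet_Icc fun s hs => ?_
      have h3 := (abs_le.1 (hqL t s)).2
      have h4 : |t - s| ≤ 1 := by rw [abs_le]; constructor <;> linarith [hs.1, hs.2]
      nlinarith
    simp at h2
    linarith
  · rw [← hq.2.2]
    refine integral_mono ((integrable_indicator_iff measurableSet_Icc).2 hint.integrableOn) hint ?_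
    intro t
    exact Set.indicator_le_self' (fun _ _ => h0 _) t

lemma cutF_prod_zero {d : ℕ} (q : Fin d → ℝ → ℝ) {x : Fin d → ℝ}
    (hx : x ∉ Set.Icc (0 : Fin d → ℝ) 1) : ∏ j, cutF (q j) (x j) = 0 := by
  obtain ⟨j, hj⟩ := notMem_cube hx
  exact Finset.prod_eq_zero (Finset.mem_univ j) (Set.indicator_of_notMem hj _)

lemma cutF_prod_eq {d : ℕ} (q : Fin d → ℝ → ℝ) {x : Fin d → ℝ}
    (hx : x ∈ Set.Icc (0 : Fin d → ℝ) 1) : ∏ j, cutF (q j) (x j) = ∏ j, q j (x j) :=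
  Finset.prod_congr rfl fun j _ => by
    have h : x j ∈ Set.Icc (0 : ℝ) 1 := ⟨hx.1 j, hx.2 j⟩
    exact Set.indicator_of_mem h _

lemma nl_tail {d : ℕ} {p : (Fin d → ℝ) → ℝ} (hp : MemD d p) (w L : ℕ → ℝ)
    (q : ℕ → Fin d → ℝ → ℝ) (hw0 : ∀ i, 0 ≤ w i) (hw : HasSum w 1)
    (hq : ∀ i j, IsPdf1 (q i j) ∧ ∀ x y, |q i j x - q i j y| ≤ L i * |x - y|)
    (hpq : ∀ᵐ x ∂(volume : Measure (Fin d → ℝ)), p x = ∑' i, w i * ∏ j, q i j (x j)) (k : ℕ) :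
    ∫ x, |p x - ∑ i : Fin k, w i * ∏ j, cutF (q i j) (x j)| ≤ ∑' i, w (i + k) := by
  set T : ℕ → (Fin d → ℝ) → ℝ := fun i x => w i * ∏ j, q i j (x j) with hT
  have hf := fun i j => pdf_facts (hq i j).1 (hq i j).2
  have hT0 : ∀ i x, 0 ≤ T i x := fun i x =>
    mul_nonneg (hw0 i) (Finset.prod_nonneg fun j _ => (hf i j).2.1 _)
  have hTi : ∀ i, Integrable (T i) := fun i =>
    (Integrable.fintype_prod (f := fun j => q i j) fun j => (hf i j).1).const_mul _
  have hTw : ∀ i, ∫ x, T i x = w i := by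
    intro i
    simp only [hT]
    rw [integral_const_mul, integral_fintype_prod_volume_eq_prod (fun j => q i j)]
    simp [(hq i _).1.2.2]
  have hsum : ∀ᵐ x ∂(volume : Measure (Fin d → ℝ)), Summable fun i => T i x := by
    have h1 : ∫⁻ x, ∑' i, ENNReal.ofReal (T i x) ≠ ⊤ := by
      rw [lintegral_tsum fun i => (hTi i).aestronglyMeasurable.aemeasurable.ennreal_ofReal]
      have : ∀ i, ∫⁻ x, ENNReal.ofReal (T i x) = ENNReal.ofReal (w i) := fun i => by
        rw [← ofReal_integral_eq_lintegral_ofReal (hTi i) (Eventually.of_forall (hT0 i)), hTw]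
      simp_rw [this]
      rw [← ENNReal.ofReal_tsum_of_nonneg hw0 hw.summable]
      exact ENNReal.ofReal_ne_top
    have h2 := ae_lt_top' (AEMeasurable.tsum fun i =>
      (hTi i).aestronglyMeasurable.aemeasurable.ennreal_ofReal) h1
    filter_upwards [h2] with x hx
    have := ENNReal.summable_toReal hx.ne
    refine this.congr fun i => ?_
    rw [ENNReal.toReal_ofReal (hT0 i x)]
  have heq : ∀ᵐ x ∂(volume : Measure (Fin d → ℝ)),
      p x - ∑ i ∈ range k, T i x = ∑' i, T (i + k) x := by
    filter_upwards [hsum, hpq] with x h1 h2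
    rw [h2, ← h1.sum_add_tsum_nat_add k]
    ring
  have hti : Integrable (fun x => ∑' i, T (i + k) x) := by
    refine Integrable.congr ?_ heq
    exact hp.integrable.sub (integrable_finsetSum _ fun i _ => hTi i)
  have hval : ∫ x, ∑' i, T (i + k) x = ∑' i, w (i + k) := by
    have := hasSum_integral_of_summable_integral_norm (F := fun i => T (i + k)) (μ := volume)
      (fun i => hTi _) (by
        have e : ∀ i, ∫ a, ‖T (i + k) a‖ = w (i + k) := fun i => by
          rw [← hTw (i + k)]
          exact integral_congr_ae (Eventually.of_forall fun x => Real.norm_of_nonneg (hT0 _ _))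
        simp_rw [e]
        exact (summable_nat_add_iff k).2 hw.summable)
    rw [← this.tsum_eq]
    simp_rw [hTw]
  rw [← hval]
  refine integral_mono_of_nonneg (Eventually.of_forall fun x => abs_nonneg _) hti ?_
  filter_upwards [heq] with x hx
  have h0 : 0 ≤ ∑' i, T (i + k) x := tsum_nonneg fun i => hT0 _ _
  by_cases hxc : x ∈ Set.Icc (0 : Fin d → ℝ) 1
  · have : ∑ i : Fin k, w i * ∏ j, cutF (q i j) (x j) = ∑ i ∈ range k, T i x := by
      rw [← Fin.sum_univ_eq_sum_range (fun i => T i x)]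
      exact Finset.sum_congr rfl fun i _ => by rw [cutF_prod_eq _ hxc]
    rw [this, hx, abs_of_nonneg h0]
  · rw [hp.2.2.2 x hxc, Finset.sum_eq_zero fun i _ => by rw [cutF_prod_zero _ hxc, mul_zero]]
    simpa using h0

def hat (m c : ℕ) (t : ℝ) : ℝ := max 0 (1 - |m * t - c|)

lemma hat_nonneg (m c : ℕ) (t : ℝ) : 0 ≤ hat m c t := le_max_left _ _
lemma hat_le_one (m c : ℕ) (t : ℝ) : hat m c t ≤ 1 :=
  max_le zero_le_one (by linarith [abs_nonneg (m * t - c)])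
lemma hat_lip (m c : ℕ) (s t : ℝ) : |hat m c s - hat m c t| ≤ m * |s - t| := by
  unfold hat
  rw [max_comm 0, max_comm 0]
  refine (abs_max_sub_max_le_abs _ _ _).trans ?_
  have : (1 - |m * s - c|) - (1 - |m * t - c|) = |m * t - c| - |m * s - c| := by ring
  rw [this]
  refine (abs_abs_sub_abs_le_abs_sub _ _).trans ?_
  have : (m * t - c) - (m * s - c) = (m : ℝ) * (t - s) := by ring
  rw [this, abs_mul, abs_sub_comm t s, Nat.abs_cast]

lemma hat_sum_aux (u : ℝ) (hu : 0 ≤ u) (m : ℕ) :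
    ∑ c ∈ range (m + 1), max 0 (1 - |u - c|) = min 1 (max 0 (m + 1 - u)) := by
  induction m with
  | zero =>
    simp [abs_of_nonneg hu, hu]
  | succ m ih =>
    rw [Finset.sum_range_succ, ih]
    push_cast
    have hm : (0 : ℝ) ≤ m := by positivity
    rcases abs_cases (u - ((m : ℝ) + 1)) with ⟨h1, h2⟩ | ⟨h1, h2⟩ <;> rw [h1] <;>
    rcases max_cases (0 : ℝ) (m + 1 - u) with ⟨h3, h4⟩ | ⟨h3, h4⟩ <;> rw [h3] <;>
    rcases max_cases (0 : ℝ) (m + 1 + 1 - u) with ⟨h5, h6⟩ | ⟨h5, h6⟩ <;> rw [h5] <;>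
    simp only [min_def, max_def] <;> split_ifs <;> linarith

lemma hat_sum (m : ℕ) (t : ℝ) (ht : t ∈ Set.Icc (0 : ℝ) 1) :
    ∑ c : Fin (m + 1), hat m c t = 1 := by
  rw [Fin.sum_univ_eq_sum_range (fun c => hat m c t)]
  unfold hat
  have hm : (0 : ℝ) ≤ m := by positivity
  rw [hat_sum_aux (m * t) (mul_nonneg hm ht.1)]
  have : (m : ℝ) * t ≤ m := mul_le_of_le_one_right hm ht.2
  rw [max_eq_right (by linarith), min_eq_left (by linarith)]

lemma hat_cut (m c : ℕ) : ∫ t, cutF (hat m c) t ≤ 1 := by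
  have h1 : ∫ t, (Set.Icc (0 : ℝ) 1).indicator (fun _ => (1 : ℝ)) t = 1 := by
    rw [integral_indicator measurableSet_Icc]; simp
  rw [← h1]
  refine integral_mono ((integrable_indicator_iff measurableSet_Icc).2
    (lip_cont (hat_lip m c)).integrableOn_Icc)
    ((integrable_indicator_iff measurableSet_Icc).2 (by simp)) fun t => ?_
  exact Set.indicator_le_indicator (hat_le_one _ _ _)

lemma hat_approx {d : ℕ} (f : (Fin d → ℝ) → ℝ) (δ ε : ℝ)
    (hf : ∀ x y, dist x y < δ → |f x - f y| ≤ ε) (m : ℕ) (hm : 0 < m) (hmδ : 1 / (m : ℝ) < δ)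
    (x : Fin d → ℝ) (hx : x ∈ Set.Icc (0 : Fin d → ℝ) 1) :
    |f x - ∑ c : Fin d → Fin (m + 1), f (fun j => (c j : ℕ) / (m : ℝ)) * ∏ j, hat m (c j) (x j)| ≤ ε := by
  have hm' : (0 : ℝ) < m := by positivity
  have h1 : ∑ c : Fin d → Fin (m + 1), ∏ j, hat m (c j) (x j) = 1 := by
    rw [← Fintype.prod_sum (fun j (c : Fin (m + 1)) => hat m c (x j))]
    exact Finset.prod_eq_one fun j _ => hat_sum m _ ⟨hx.1 j, hx.2 j⟩
  have h2 : f x - ∑ c : Fin d → Fin (m + 1), f (fun j => (c j : ℕ) / (m : ℝ)) * ∏ j, hat m (c j) (x j)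
      = ∑ c : Fin d → Fin (m + 1), (f x - f (fun j => (c j : ℕ) / (m : ℝ))) * ∏ j, hat m (c j) (x j) := by
    simp_rw [sub_mul]
    rw [Finset.sum_sub_distrib, ← Finset.mul_sum, h1, mul_one]
  rw [h2]
  refine (Finset.abs_sum_le_sum_abs _ _).trans ?_
  have h3 : ∀ c : Fin d → Fin (m + 1), |(f x - f (fun j => (c j : ℕ) / (m : ℝ))) * ∏ j, hat m (c j) (x j)|
      ≤ ε * ∏ j, hat m (c j) (x j) := by
    intro c
    have hP : 0 ≤ ∏ j, hat m (c j) (x j) := Finset.prod_nonneg fun j _ => hat_nonneg _ _ _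
    rw [abs_mul, abs_of_nonneg hP]
    by_cases h0 : ∏ j, hat m (c j) (x j) = 0
    · rw [h0]; simp
    · refine mul_le_mul_of_nonneg_right (hf _ _ ?_) hP
      refine lt_of_le_of_lt ((dist_pi_le_iff (by positivity)).2 fun j => ?_) hmδ
      have h4 : hat m (c j) (x j) ≠ 0 := fun h => h0 (Finset.prod_eq_zero (Finset.mem_univ j) h)
      have h5 : |m * x j - (c j : ℕ)| ≤ 1 := by
        by_contra hcon
        exact h4 (max_eq_left (by linarith))
      rw [Real.dist_eq]
      have h6 : x j - (c j : ℕ) / (m : ℝ) = (m * x j - (c j : ℕ)) / m := by field_simp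
      rw [h6, abs_div, abs_of_pos hm']
      exact div_le_div_of_nonneg_right h5 hm'.le
  refine (Finset.sum_le_sum fun c _ => h3 c).trans ?_
  rw [← Finset.mul_sum, h1, mul_one]

lemma density {d : ℕ} {p : (Fin d → ℝ) → ℝ} (hp : MemD d p) (ε : ℝ) (hε : 0 < ε) :
    ∃ (K : ℕ) (L B : ℝ) (w : ℕ → ℝ) (q : ℕ → Fin d → ℝ → ℝ), 0 ≤ L ∧ 0 ≤ B ∧
      (∀ i, 0 ≤ w i) ∧ (∀ i, w i ≤ B) ∧ (∀ i j t, 0 ≤ q i j t) ∧ (∀ i j t, q i j t ≤ 1) ∧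
      (∀ i j s t, |q i j s - q i j t| ≤ L * |s - t|) ∧ (∀ i j, ∫ t, cutF (q i j) t ≤ 1) ∧
      ∀ k, K ≤ k → (∑ i : Fin k, w i) ≤ B ∧
        ∫ x, |p x - ∑ i : Fin k, w i * ∏ j, cutF (q i j) (x j)| ≤ 2 * ε := by
  classical
  obtain ⟨f, hfc, hfp, hfcont, hfint⟩ := hp.integrable.exists_hasCompactSupport_integral_sub_le hε
  have huc : UniformContinuous f := hfc.uniformContinuous_of_continuous hfcont
  obtain ⟨δ, hδ, hfδ⟩ := Metric.uniformContinuous_iff.1 huc ε hε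
  set f0 : (Fin d → ℝ) → ℝ := fun x => max (f x) 0 with hf0
  have hf0δ : ∀ x y, dist x y < δ → |f0 x - f0 y| ≤ ε := fun x y h =>
    (abs_max_sub_max_le_abs _ _ _).trans (by have := hfδ h; rw [Real.dist_eq] at this; exact this.le)
  obtain ⟨m, hm⟩ := exists_nat_one_div_lt hδ
  set M := m + 1 with hM
  have hmδ : 1 / (M : ℝ) < δ := by rw [hM]; push_cast; exact hm
  let e := Fintype.equivFin (Fin d → Fin (M + 1))
  set K := Fintype.card (Fin d → Fin (M + 1)) with hK
  let w : ℕ → ℝ := fun i => if h : i < K then f0 (fun j => (e.symm ⟨i, h⟩ j : ℕ) / (M : ℝ)) else 0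
  let q : ℕ → Fin d → ℝ → ℝ := fun i j => if h : i < K then hat M (e.symm ⟨i, h⟩ j) else 0
  have hw0 : ∀ i, 0 ≤ w i := fun i => by
    simp only [w]; split_ifs; exacts [le_max_right _ _, le_rfl]
  have hwK : ∀ i, K ≤ i → w i = 0 := fun i hi => by simp [w, not_lt.2 hi]
  have hsumK : ∀ (r : ℕ → ℝ), (∀ i, K ≤ i → r i = 0) → ∀ k, K ≤ k →
      ∑ i : Fin k, r i = ∑ i : Fin K, r i := by
    intro r hr k hk
    rw [Fin.sum_univ_eq_sum_range, Fin.sum_univ_eq_sum_range]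
    refine (Finset.sum_subset (Finset.range_mono hk) fun i _ hi => hr i ?_).symm
    simpa using hi
  refine ⟨K, M, ∑ i : Fin K, w i, w, q, by positivity, Finset.sum_nonneg fun i _ => hw0 i, hw0, ?_, ?_, ?_,
    ?_, ?_, ?_⟩
  · intro i
    by_cases h : i < K
    · exact Finset.single_le_sum (f := fun i : Fin K => w i) (fun i _ => hw0 i) (Finset.mem_univ ⟨i, h⟩)
    · rw [hwK i (not_lt.1 h)]; exact Finset.sum_nonneg fun i _ => hw0 i
  · intro i j t
    simp only [q]; split_ifs
    · exact hat_nonneg _ _ _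
    · exact le_rfl
  · intro i j t
    simp only [q]; split_ifs
    · exact hat_le_one _ _ _
    · exact zero_le_one
  · intro i j s t
    simp only [q]; split_ifs
    · exact hat_lip _ _ _ _
    · simp; positivity
  · intro i j
    simp only [q]; split_ifs
    · exact hat_cut _ _
    · simp [cutF]
  · intro k hk
    refine ⟨(hsumK w hwK k hk).le, ?_⟩
    have hF : ∀ x : Fin d → ℝ, ∑ i : Fin k, w i * ∏ j, cutF (q i j) (x j) =
        ∑ c : Fin d → Fin (M + 1), f0 (fun j => (c j : ℕ) / (M : ℝ)) * ∏ j, cutF (hat M (c j)) (x j) := by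
      intro x
      rw [hsumK (fun i => w i * ∏ j, cutF (q i j) (x j)) (fun i hi => by simp [hwK i hi]) k hk,
        ← Equiv.sum_comp e.symm]
      refine Finset.sum_congr rfl fun i _ => ?_
      simp [w, q]
    simp_rw [hF]
    have hint1 : Integrable (fun x => |p x - f x|) := (hp.integrable.sub hfint).abs
    have hint2 : Integrable ((Set.Icc (0 : Fin d → ℝ) 1).indicator fun _ => ε) :=
      (integrable_indicator_iff measurableSet_Icc).2 (by simp [isCompact_Icc.measure_lt_top])
    have hv : ∫ x, (Set.Icc (0 : Fin d → ℝ) 1).indicator (fun _ => ε) x = ε := by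
      rw [integral_indicator measurableSet_Icc]
      simp [Measure.real, Real.volume_Icc_pi]
    have hfin : ∫ x, (|p x - f x| + (Set.Icc (0 : Fin d → ℝ) 1).indicator (fun _ => ε) x) ≤ 2 * ε := by
      rw [integral_add hint1 hint2, hv]
      simp only [Real.norm_eq_abs] at hfp
      linarith
    refine le_trans (integral_mono_of_nonneg (Eventually.of_forall fun x => abs_nonneg _)
      (hint1.add hint2) ?_) hfin
    filter_upwards [hp.2.1] with x hx0
    simp only [Pi.add_apply]
    by_cases hx : x ∈ Set.Icc (0 : Fin d → ℝ) 1
    · rw [Set.indicator_of_mem hx]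
      have h1 := hat_approx f0 δ ε hf0δ M (by omega) hmδ x hx
      have h2 : |p x - f0 x| ≤ |p x - f x| := by
        have := abs_max_sub_max_le_abs (p x) (f x) 0
        rwa [max_eq_left hx0] at this
      rw [Finset.sum_congr rfl fun c _ => by rw [cutF_prod_eq (fun j => hat M (c j)) hx]]
      exact (abs_sub_le _ _ _).trans (add_le_add h2 h1)
    · rw [Set.indicator_of_notMem hx, hp.2.2.2 x hx,
        Finset.sum_eq_zero fun c _ => by rw [cutF_prod_zero (fun j => hat M (c j)) hx, mul_zero]]
      simp

def kk (α β : ℝ) (n : ℕ) : ℕ := ⌊(n : ℝ) ^ (1 / (3 * α + β + 1))⌋₊ + 1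
def bb (α β : ℝ) (n : ℕ) : ℕ := ⌊(n : ℝ) ^ ((α + β) / (3 * α + β + 1))⌋₊ + 1
def RR (α β : ℝ) (n : ℕ) : ℝ := (n : ℝ) ^ (-(α / (3 * α + β + 1)))
def CC (d : ℕ) : ℝ := 12 * (1 + 3 * d) + 1
def tt (α β : ℝ) (d n : ℕ) : ℝ := CC d * (RR α β n * Real.log n)

lemma RR_pos (α β : ℝ) {n : ℕ} (hn : 0 < n) : 0 < RR α β n := by
  have : (0 : ℝ) < n := by positivity
  exact Real.rpow_pos_of_pos this _

lemma kk_bounds {α β : ℝ} (hα : 0 < α) (hβ : 0 < β) {n : ℕ} (hn : 0 < n) :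
    (n : ℝ) ^ (1 / (3 * α + β + 1)) ≤ kk α β n ∧ (kk α β n : ℝ) ≤ 2 * (n : ℝ) ^ (1 / (3 * α + β + 1)) := by
  have h1 : (1 : ℝ) ≤ n := by exact_mod_cast hn
  have h2 : (1 : ℝ) ≤ (n : ℝ) ^ (1 / (3 * α + β + 1)) := Real.one_le_rpow h1 (by positivity)
  unfold kk
  push_cast
  exact ⟨(Nat.lt_floor_add_one _).le, by linarith [Nat.floor_le (zero_le_one.trans h2)]⟩

lemma bb_bounds {α β : ℝ} (hα : 0 < α) (hβ : 0 < β) {n : ℕ} (hn : 0 < n) :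
    (n : ℝ) ^ ((α + β) / (3 * α + β + 1)) ≤ bb α β n ∧
      (bb α β n : ℝ) + 1 ≤ 3 * (n : ℝ) ^ ((α + β) / (3 * α + β + 1)) := by
  have h1 : (1 : ℝ) ≤ n := by exact_mod_cast hn
  have h2 : (1 : ℝ) ≤ (n : ℝ) ^ ((α + β) / (3 * α + β + 1)) := Real.one_le_rpow h1 (by positivity)
  unfold bb
  push_cast
  exact ⟨(Nat.lt_floor_add_one _).le, by linarith [Nat.floor_le (zero_le_one.trans h2)]⟩

lemma card_Par (d k b n : ℕ) :
    Fintype.card (Par d k b n) = (n ^ 2 + 1) ^ (k + (b + 1) * d * k) := by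
  simp [Par, pow_add, pow_mul]

lemma prob_arith {α β : ℝ} (hα : 0 < α) (hβ : 0 < β) (d : ℕ) {n : ℕ} (hn : 3 ≤ n) :
    (Fintype.card (Par d (kk α β n) (bb α β n) n) : ℝ) ^ 2 *
      (2 * Real.exp (-2 * n * (tt α β d n) ^ 2)) ≤ 2 / n := by
  have hn0 : (0 : ℝ) < n := by positivity
  have hn3 : (3 : ℝ) ≤ n := by exact_mod_cast hn
  have hs : 0 < 3 * α + β + 1 := by positivity
  set X := (n : ℝ) ^ (1 / (3 * α + β + 1)) with hX
  set Y := (n : ℝ) ^ ((α + β) / (3 * α + β + 1)) with hY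
  have hX1 : 1 ≤ X := Real.one_le_rpow (by linarith) (by positivity)
  have hY1 : 1 ≤ Y := Real.one_le_rpow (by linarith) (by positivity)
  have hl1 : 1 ≤ Real.log n := by
    rw [Real.le_log_iff_exp_le hn0]
    linarith [Real.exp_one_lt_d9]
  set l := Real.log n with hl
  have hlog : Real.log ((n : ℝ) ^ 2 + 1) ≤ 3 * l := by
    have : 3 * l = Real.log ((n : ℝ) ^ 3) := by rw [Real.log_pow, ← hl]; norm_num
    rw [this]
    exact Real.log_le_log (by positivity) (by nlinarith)
  set E : ℕ := kk α β n + (bb α β n + 1) * d * kk α β n with hE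
  have hEb : (E : ℝ) ≤ 2 * (1 + 3 * d) * (X * Y) := by
    have hk := (kk_bounds hα hβ (n := n) (by omega)).2
    have hb := (bb_bounds hα hβ (n := n) (by omega)).2
    rw [← hX] at hk
    rw [← hY] at hb
    rw [hE]
    push_cast
    have hd0 : (0 : ℝ) ≤ d := by positivity
    have hk0 : (0 : ℝ) ≤ kk α β n := by positivity
    calc (kk α β n : ℝ) + (bb α β n + 1) * d * kk α β n
        = (1 + (bb α β n + 1) * d) * kk α β n := by ring
      _ ≤ (Y + 3 * Y * d) * (2 * X) := by
          refine mul_le_mul (add_le_add hY1 (mul_le_mul_of_nonneg_right hb hd0)) hk hk0 (by positivity)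
      _ = _ := by ring
  have hcard : (Fintype.card (Par d (kk α β n) (bb α β n) n) : ℝ) ^ 2 ≤
      Real.exp (12 * (1 + 3 * d) * (X * Y) * l) := by
    rw [card_Par]
    push_cast
    rw [← hE, ← pow_mul, ← Real.exp_log (show (0 : ℝ) < (n : ℝ) ^ 2 + 1 by positivity),
      ← Real.exp_nat_mul]
    apply Real.exp_le_exp.2
    push_cast
    calc (E : ℝ) * 2 * Real.log ((n : ℝ) ^ 2 + 1) ≤ (2 * (1 + 3 * d) * (X * Y)) * 2 * (3 * l) := by
          refine mul_le_mul (by linarith) hlog (Real.log_nonneg (by nlinarith)) (by positivity)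
      _ = _ := by ring
  have hnt : (n : ℝ) * (RR α β n) ^ 2 = X * Y := by
    rw [RR, hX, hY, ← Real.rpow_natCast, ← Real.rpow_mul hn0.le, ← Real.rpow_add hn0]
    conv_lhs => enter [1]; rw [← Real.rpow_one (n : ℝ)]
    rw [← Real.rpow_add hn0]
    congr 1
    push_cast
    field_simp
    ring
  have hC : 1 ≤ CC d := by unfold CC; have : (0 : ℝ) ≤ d := by positivity
                           linarith
  have hexp : -2 * (n : ℝ) * (tt α β d n) ^ 2 ≤ -(CC d * (X * Y) * l) := by
    have : -2 * (n : ℝ) * (tt α β d n) ^ 2 = -2 * ((CC d * CC d) * (X * Y) * (l * l)) := by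
      rw [← hnt, tt]; ring
    rw [this]
    have h1 : CC d * (X * Y) * l ≤ (CC d * CC d) * (X * Y) * (l * l) := by
      have hXY : 0 ≤ X * Y := by positivity
      refine mul_le_mul (mul_le_mul_of_nonneg_right (by nlinarith) hXY) (by nlinarith) (by positivity)
        (by positivity)
    have h2 : 0 ≤ CC d * (X * Y) * l := by positivity
    linarith
  calc _ ≤ Real.exp (12 * (1 + 3 * d) * (X * Y) * l) * (2 * Real.exp (-(CC d * (X * Y) * l))) := by
        refine mul_le_mul hcard (mul_le_mul_of_nonneg_left (Real.exp_le_exp.2 hexp) (by norm_num))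
          (by positivity) (by positivity)
    _ = 2 * Real.exp (-(X * Y * l)) := by
        rw [mul_left_comm, ← Real.exp_add]
        congr 2
        unfold CC
        ring
    _ ≤ 2 * Real.exp (-l) := by
        refine mul_le_mul_of_nonneg_left (Real.exp_le_exp.2 ?_) (by norm_num)
        have : 1 ≤ X * Y := one_le_mul_of_one_le_of_one_le hX1 hY1
        nlinarith
    _ = 2 / n := by
        rw [Real.exp_neg, hl, Real.exp_log hn0, div_eq_mul_inv]

lemma RR_tendsto {α β : ℝ} (hα : 0 < α) (hβ : 0 < β) : Tendsto (RR α β) atTop (nhds 0) :=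
  (tendsto_rpow_neg_atTop (by positivity)).comp tendsto_natCast_atTop_atTop

lemma RRlog_tendsto {α β : ℝ} (hα : 0 < α) (hβ : 0 < β) :
    Tendsto (fun n : ℕ => RR α β n * Real.log n) atTop (nhds 0) := by
  have h := (isLittleO_log_rpow_atTop (r := α / (3 * α + β + 1)) (by positivity)).tendsto_div_nhds_zero
  have h2 := h.comp (tendsto_natCast_atTop_atTop (R := ℝ))
  refine h2.congr fun n => ?_
  simp only [Function.comp, RR]
  rw [Real.rpow_neg (by positivity), div_eq_mul_inv, mul_comm]

lemma kk_div {α β : ℝ} (hα : 0 < α) (hβ : 0 < β) {n : ℕ} (hn : 0 < n) :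
    (kk α β n : ℝ) / n ≤ 2 * RR α β n ∧ 1 / (n : ℝ) ≤ RR α β n ∧ 1 / (bb α β n : ℝ) ≤ RR α β n ∧
    (n : ℝ) ^ (β / (3 * α + β + 1)) / bb α β n ≤ RR α β n ∧
    (n : ℝ) ^ (β / (3 * α + β + 1)) ≤ n * RR α β n ∧
    (kk α β n : ℝ) ^ (-α) ≤ RR α β n ∧
    (kk α β n : ℝ) ^ β ≤ 2 ^ β * (n : ℝ) ^ (β / (3 * α + β + 1)) := by
  have hn0 : (0 : ℝ) < n := by positivity
  have hn1 : (1 : ℝ) ≤ n := by exact_mod_cast hn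
  have hs : 0 < 3 * α + β + 1 := by positivity
  obtain ⟨hk1, hk2⟩ := kk_bounds hα hβ hn
  obtain ⟨hb1, hb2⟩ := bb_bounds hα hβ hn
  have hY0 : 0 < (n : ℝ) ^ ((α + β) / (3 * α + β + 1)) := Real.rpow_pos_of_pos hn0 _
  have hX0 : 0 < (n : ℝ) ^ (1 / (3 * α + β + 1)) := Real.rpow_pos_of_pos hn0 _
  have hb0 : (0 : ℝ) < bb α β n := hY0.trans_le hb1
  have hinv : 1 / (n : ℝ) = (n : ℝ) ^ (-1 : ℝ) := by rw [Real.rpow_neg_one, one_div]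
  refine ⟨?_, ?_, ?_, ?_, ?_, ?_, ?_⟩
  · refine (div_le_div_of_nonneg_right hk2 hn0.le).trans ?_
    rw [mul_div_assoc, div_eq_mul_one_div _ (n : ℝ), hinv, ← Real.rpow_add hn0]
    refine mul_le_mul_of_nonneg_left (Real.rpow_le_rpow_of_exponent_le hn1 ?_) (by norm_num)
    rw [← sub_nonneg]
    have : -(α / (3 * α + β + 1)) - (1 / (3 * α + β + 1) + -1) = (2 * α + β) / (3 * α + β + 1) := by
      field_simp; ring
    rw [this]; positivity
  · rw [hinv]
    refine Real.rpow_le_rpow_of_exponent_le hn1 ?_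
    rw [neg_le_neg_iff, div_le_one hs]
    linarith
  · refine (one_div_le_one_div_of_le hY0 hb1).trans ?_
    rw [one_div, ← Real.rpow_neg hn0.le]
    refine Real.rpow_le_rpow_of_exponent_le hn1 ?_
    rw [neg_le_neg_iff]
    exact div_le_div_of_nonneg_right (by linarith) hs.le
  · refine (div_le_div_of_nonneg_left (by positivity) hY0 hb1).trans ?_
    rw [← Real.rpow_sub hn0]
    refine Real.rpow_le_rpow_of_exponent_le hn1 (le_of_eq ?_)
    field_simp; ring
  · rw [RR]
    conv_rhs => enter [1]; rw [← Real.rpow_one (n : ℝ)]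
    rw [← Real.rpow_add hn0]
    refine Real.rpow_le_rpow_of_exponent_le hn1 ?_
    rw [← sub_nonneg]
    have : 1 + -(α / (3 * α + β + 1)) - β / (3 * α + β + 1) = (2 * α + 1) / (3 * α + β + 1) := by
      field_simp; ring
    rw [this]; positivity
  · refine (Real.rpow_le_rpow_of_nonpos hX0 hk1 (by linarith)).trans (le_of_eq ?_)
    rw [← Real.rpow_mul hn0.le, RR]
    congr 1; ring
  · refine (Real.rpow_le_rpow (by positivity) hk2 hβ.le).trans (le_of_eq ?_)
    rw [Real.mul_rpow (by norm_num) hX0.le, ← Real.rpow_mul hn0.le]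
    congr 2; ring

lemma meas_pick {Θ A B : Type} [Countable Θ] [MeasurableSpace Θ] [MeasurableSingletonClass Θ]
    [MeasurableSpace A] [MeasurableSpace B] (F : Θ → B → ℝ) (hF : ∀ θ, Measurable (F θ))
    {T : A → Θ} (hT : Measurable T) : Measurable (fun z : A × B => F (T z.1) z.2) := by
  have h1 : Measurable (fun z : Θ × B => F z.1 z.2) :=
    measurable_from_prod_countable_right fun θ => hF θ
  exact h1.comp ((hT.comp measurable_fst).prodMk measurable_snd)

theorem nl_main (α β : ℝ) (hα : 0 < α) (hβ : 0 < β) (d : ℕ) :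
    ∃ V : (n : ℕ) → (Fin n → Fin d → ℝ) → (Fin d → ℝ) → ℝ,
      (∀ n xs, MemD d (V n xs)) ∧
      (∀ n, Measurable (fun z : (Fin n → Fin d → ℝ) × (Fin d → ℝ) => V n z.1 z.2)) ∧
      ∀ n, 3 ≤ n → ∀ p, MemD d p → ∀ η, ∀ θ : Par d (kk α β n) (bb α β n) n,
        ∫ x, |p x - gF θ x| ≤ η →
        sampleMeasure d n p {xs | 10 * η + 4 * tt α β d n < ∫ x, |p x - V n xs x|} ≤
          ENNReal.ofReal (2 / n) := by
  have hT : ∀ n : ℕ, ∃ T : (Fin n → Fin d → ℝ) → Par d (kk α β n) (bb α β n) n, Measurable T ∧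
      (0 < n → ∀ p, MemD d p → ∀ (θ : Par d (kk α β n) (bb α β n) n) (t : ℝ), 0 ≤ t →
        sampleMeasure d n p {xs | 5 * (∫ x, |p x - fF θ x|) + 4 * t < ∫ x, |p x - fF (T xs) x|} ≤
          ENNReal.ofReal ((Fintype.card (Par d (kk α β n) (bb α β n) n) : ℝ) ^ 2 *
            (2 * Real.exp (-2 * n * t ^ 2)))) := by
    intro n
    rcases Nat.eq_zero_or_pos n with h | h
    · exact ⟨fun _ => (fun _ => 0, fun _ _ _ => 0), measurable_const, fun h' => by omega⟩
    · obtain ⟨T, h1, h2⟩ := mde h (fun θ : Par d (kk α β n) (bb α β n) n => fF θ) fF_memD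
      exact ⟨T, h1, fun _ => h2⟩
  choose T hTm hT using hT
  refine ⟨fun n xs => fF (T n xs), fun n xs => fF_memD _, fun n => ?_, ?_⟩
  · exact meas_pick (fun θ : Par d (kk α β n) (bb α β n) n => fF θ) (fun θ => (fF_memD θ).1) (hTm n)
  · intro n hn p hp η θ hη
    have ht : 0 ≤ tt α β d n := by
      have h1 : 0 < RR α β n := RR_pos α β (by omega)
      have h2 : 0 ≤ Real.log n := Real.log_natCast_nonneg n
      unfold tt CC
      positivity
    refine le_trans (measure_mono ?_) ((hT n (by omega) p hp θ _ ht).trans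
      (ENNReal.ofReal_le_ofReal (prob_arith hα hβ d hn)))
    intro xs hxs
    simp only [Set.mem_ofPred_eq] at hxs ⊢
    have := fF_close θ hp
    linarith

lemma sum_L1 {d k b n : ℕ} {p : (Fin d → ℝ) → ℝ} (hp : MemD d p) (w : ℕ → ℝ)
    (q : ℕ → Fin d → ℝ → ℝ) (hqc : ∀ i j, Continuous (q i j)) (θ : Par d k b n) (a c : ℝ)
    (h1 : ∫ x, |p x - ∑ i : Fin k, w i * ∏ j, cutF (q i j) (x j)| ≤ a)
    (h2 : ∫ x, |(∑ i : Fin k, w i * ∏ j, cutF (q i j) (x j)) - gF θ x| ≤ c) :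
    ∫ x, |p x - gF θ x| ≤ a + c := by
  have hi : Integrable (fun x : Fin d → ℝ => ∑ i : Fin k, w i * ∏ j, cutF (q i j) (x j)) :=
    integrable_finsetSum _ fun i _ => (Integrable.fintype_prod (f := fun j => cutF (q i j))
      fun j => (integrable_indicator_iff measurableSet_Icc).2 ((hqc i j).integrableOn_Icc)).const_mul _
  exact (l1_tri hp.integrable hi (gF_int θ)).trans (add_le_add h1 h2)

lemma tendsto_two_div : Tendsto (fun n : ℕ => ENNReal.ofReal (2 / n)) atTop (nhds 0) := by
  rw [← ENNReal.ofReal_zero]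
  exact ENNReal.tendsto_ofReal (tendsto_const_div_atTop_nhds_zero_nat 2)

lemma consist {α β : ℝ} (hα : 0 < α) (hβ : 0 < β) {d : ℕ} {p : (Fin d → ℝ) → ℝ} (hp : MemD d p)
    (ε : ℝ) (hε : 0 < ε) :
    ∀ᶠ n : ℕ in atTop, ∃ θ : Par d (kk α β n) (bb α β n) n, ∫ x, |p x - gF θ x| ≤ 3 * ε := by
  obtain ⟨K, L, B, w, q, hL, hB, hw0, hwB, hq0, hq1, hqL, hqc, hk⟩ := density hp ε hε
  have hR := RR_tendsto hα hβ
  have e1 : ∀ᶠ n : ℕ in atTop, (B * (d * (2 * L + 1)) + 2) * RR α β n < ε := by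
    have := hR.const_mul (B * (d * (2 * L + 1)) + 2)
    rw [mul_zero] at this
    exact this.eventually_lt_const hε
  have e2 : ∀ᶠ n : ℕ in atTop, (K : ℝ) ≤ (n : ℝ) ^ (1 / (3 * α + β + 1)) :=
    ((tendsto_rpow_atTop (by positivity)).comp tendsto_natCast_atTop_atTop).eventually_ge_atTop (K : ℝ)
  have e3 : ∀ᶠ n : ℕ in atTop, B ≤ (n : ℝ) := tendsto_natCast_atTop_atTop.eventually_ge_atTop B
  filter_upwards [e1, e2, e3, eventually_ge_atTop 1] with n h1 h2 h3 h4
  have hn1 : (1 : ℝ) ≤ n := by exact_mod_cast h4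
  have hKk : K ≤ kk α β n := by exact_mod_cast h2.trans (kk_bounds hα hβ h4).1
  obtain ⟨θ, hθ⟩ := class_approx (d := d) (k := kk α β n) (b := bb α β n) (n := n)
    (Nat.succ_pos _) h4 L hL (fun i => w i) (fun i => hw0 i) (fun i => (hwB i).trans h3)
    (fun i j => q i j) (fun i j t => hq0 i j t) (fun i j t _ => (hq1 i j t).trans hn1)
    (fun i j => hqL i j) (fun i j => hqc i j)
  refine ⟨θ, ?_⟩
  obtain ⟨hB', happ⟩ := hk _ hKk
  refine (sum_L1 hp w q (fun i j => lip_cont (hqL i j)) θ _ _ happ hθ).trans ?_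
  obtain ⟨g1, g2, g3, -⟩ := kk_div hα hβ (n := n) h4
  have hRp := RR_pos α β (n := n) h4
  have hd0 : (0 : ℝ) ≤ d := by positivity
  have h5 : 2 * L / (bb α β n : ℝ) + 1 / n ≤ (2 * L + 1) * RR α β n := by
    rw [div_eq_mul_one_div (2 * L)]
    have := mul_le_mul_of_nonneg_left g3 (show 0 ≤ 2 * L by positivity)
    linarith
  have h6 : (∑ i : Fin (kk α β n), w i) * (d * (2 * L / (bb α β n : ℝ) + 1 / n)) ≤
      B * (d * ((2 * L + 1) * RR α β n)) :=
    mul_le_mul hB' (mul_le_mul_of_nonneg_left h5 hd0) (by positivity) hB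
  linarith

lemma rate {α β : ℝ} (hα : 0 < α) (hβ : 0 < β) {d : ℕ} {p : (Fin d → ℝ) → ℝ} (hp : MemD d p)
    (W Lt : ℕ → ℝ) (hW : ∀ i, 0 ≤ W i) (hLt : ∀ i, 0 ≤ Lt i) (hpc : MemNLClass d p W Lt)
    (CW CL : ℝ) (hCW : ∀ k : ℕ, W k ≤ CW * ((k : ℝ) + 1) ^ (-α))
    (hCL : ∀ k : ℕ, Lt k ≤ CL * ((k : ℝ) + 1) ^ β) :
    ∃ c, 0 ≤ c ∧ ∀ᶠ n : ℕ in atTop, ∃ θ : Par d (kk α β n) (bb α β n) n,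
      ∫ x, |p x - gF θ x| ≤ c * RR α β n := by
  obtain ⟨w, L, ⟨q, hw0, -, hw, hq, hpq⟩, hwL⟩ := hpc
  have hCW0 : 0 ≤ CW := by have := (hW 0).trans (hCW 0); simpa using this
  have hCL0 : 0 ≤ CL := by have := (hLt 0).trans (hCL 0); simpa using this
  have h2β : (0 : ℝ) < 2 ^ β := by positivity
  have hf := fun i j => pdf_facts (hq i j).1 (hq i j).2
  have hw1 : ∀ i, w i ≤ 1 := fun i => le_hasSum hw i fun j _ => hw0 j
  have hR := RR_tendsto hα hβ
  refine ⟨CW + (d * (2 * (CL * 2 ^ β) + 1) + 2), by positivity, ?_⟩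
  have e1 : ∀ᶠ n : ℕ in atTop, (1 + CL * 2 ^ β) * RR α β n < 1 := by
    have := hR.const_mul (1 + CL * 2 ^ β)
    rw [mul_zero] at this
    exact this.eventually_lt_const zero_lt_one
  filter_upwards [e1, eventually_ge_atTop 1] with n h1 h4
  have hn1 : (1 : ℝ) ≤ n := by exact_mod_cast h4
  have hn0 : (0 : ℝ) < n := by linarith
  obtain ⟨g1, g2, g3, g4, g5, g6, g7⟩ := kk_div hα hβ (n := n) h4
  have hRp := RR_pos α β (n := n) h4
  have hd0 : (0 : ℝ) ≤ d := by positivity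
  set Z := (n : ℝ) ^ (β / (3 * α + β + 1)) with hZ
  have hZ1 : 1 ≤ Z := Real.one_le_rpow hn1 (by positivity)
  set M := CL * 2 ^ β * Z with hM
  have hM0 : 0 ≤ M := by positivity
  have hLM : ∀ i : Fin (kk α β n), L i ≤ M := by
    intro i
    refine ((hwL i).1.trans (hCL i)).trans ?_
    rw [hM, mul_assoc]
    refine mul_le_mul_of_nonneg_left (le_trans ?_ g7) hCL0
    refine Real.rpow_le_rpow (by positivity) ?_ hβ.le
    exact_mod_cast i.2
  have hMn : 1 + M ≤ n := by
    have : 1 + M ≤ (1 + CL * 2 ^ β) * Z := by rw [hM]; linarith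
    refine this.trans ((mul_le_mul_of_nonneg_left g5 (by positivity)).trans ?_)
    nlinarith
  have hqM : ∀ (i : Fin (kk α β n)) j s t, |q i j s - q i j t| ≤ M * |s - t| := fun i j s t =>
    ((hq i j).2 s t).trans (mul_le_mul_of_nonneg_right (hLM i) (abs_nonneg _))
  obtain ⟨θ, hθ⟩ := class_approx (d := d) (k := kk α β n) (b := bb α β n) (n := n)
    (Nat.succ_pos _) h4 M hM0 (fun i => w i) (fun i => hw0 i) (fun i => (hw1 i).trans hn1)
    (fun i j => q i j) (fun i j t => (hf i j).2.1 t)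
    (fun i j t _ => ((hf i j).2.2.1 t).trans (by linarith [hLM i])) hqM (fun i j => (hf i j).2.2.2)
  refine ⟨θ, ?_⟩
  have htail : ∑' i, w (i + kk α β n) ≤ CW * RR α β n := by
    refine ((hwL _).2.trans (hCW _)).trans (mul_le_mul_of_nonneg_left (le_trans (le_of_eq ?_) g6) hCW0)
    unfold kk
    push_cast
    rfl
  refine (sum_L1 hp w q (fun i j => lip_cont (hq i j).2) θ _ _
    ((nl_tail hp w L q hw0 hw hq hpq _).trans htail) hθ).trans ?_
  have h5 : 2 * M / (bb α β n : ℝ) + 1 / n ≤ (2 * (CL * 2 ^ β) + 1) * RR α β n := by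
    have e : 2 * M / (bb α β n : ℝ) = 2 * (CL * 2 ^ β) * (Z / bb α β n) := by rw [hM]; ring
    rw [e]
    have := mul_le_mul_of_nonneg_left g4 (show 0 ≤ 2 * (CL * 2 ^ β) by positivity)
    linarith
  have hsum : (∑ i : Fin (kk α β n), w i) ≤ 1 := by
    rw [Fin.sum_univ_eq_sum_range]
    exact sum_le_hasSum _ (fun i _ => hw0 i) hw
  have h6 : (∑ i : Fin (kk α β n), w i) * (d * (2 * M / (bb α β n : ℝ) + 1 / n)) ≤
      1 * (d * ((2 * (CL * 2 ^ β) + 1) * RR α β n)) :=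
    mul_le_mul hsum (mul_le_mul_of_nonneg_left h5 hd0) (by positivity) zero_le_one
  linarith

/-- **Proposition 5.** A universally consistent sequence of estimators achieving, on every
NL-class with polynomial rates `W_k ∈ O(k^{-α})`, `L_k ∈ O(k^β)`, the high-probability rate
`‖V_n − p‖₁ ∈ Õ(n^{−α/(3α+β+1)})` (i.e. `O` up to a polylogarithmic factor `C (log n)^γ`).
Sequences are `0`-indexed: index `k` is the paper's `k+1`. -/
theorem nl_class_polynomial_rate
    (α β : ℝ) (hα : 0 < α) (hβ : 0 < β) (d : ℕ) (hd : 1 ≤ d) :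
    ∃ V : (n : ℕ) → (Fin n → Fin d → ℝ) → (Fin d → ℝ) → ℝ,
      (∀ n xs, MemD d (V n xs)) ∧
      (∀ n, Measurable (fun z : (Fin n → Fin d → ℝ) × (Fin d → ℝ) => V n z.1 z.2)) ∧
      -- universal consistency on 𝒟_d: L¹ error → 0 in probability for every p ∈ 𝒟_d
      (∀ p : (Fin d → ℝ) → ℝ, MemD d p → ∀ ε : ℝ, 0 < ε →
        Tendsto (fun n =>
            sampleMeasure d n p {xs | ε < ∫ x, |p x - V n xs x|})
          atTop (nhds 0)) ∧
      -- Õ(n^{-α/(3α+β+1)}) rate, with high probability, on the NL-class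
      (∀ (p : (Fin d → ℝ) → ℝ) (W Lt : ℕ → ℝ),
        (∀ i, 0 ≤ W i) → (∀ i, W (i + 1) ≤ W i) → Tendsto W atTop (nhds 0) →
        (∀ i, 0 ≤ Lt i) → (∀ i, Lt i ≤ Lt (i + 1)) →
        MemD d p → MemNLClass d p W Lt →
        (∃ CW : ℝ, ∀ k : ℕ, W k ≤ CW * ((k : ℝ) + 1) ^ (-α)) →
        (∃ CL : ℝ, ∀ k : ℕ, Lt k ≤ CL * ((k : ℝ) + 1) ^ β) →
        ∃ C γ : ℝ, Tendsto (fun n =>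
            sampleMeasure d n p
              {xs | C * Real.log n ^ γ * (n : ℝ) ^ (-(α / (3 * α + β + 1)))
                < ∫ x, |p x - V n xs x|})
          atTop (nhds 0)) := by
  obtain ⟨V, hV1, hV2, hV3⟩ := nl_main α β hα hβ d
  refine ⟨V, hV1, hV2, ?_, ?_⟩
  · intro p hp ε hε
    refine tendsto_of_tendsto_of_tendsto_of_le_of_le' tendsto_const_nhds tendsto_two_div
      (Eventually.of_forall fun _ => zero_le) ?_
    have e1 : ∀ᶠ n : ℕ in atTop, 4 * tt α β d n < ε / 2 := by
      have := (RRlog_tendsto hα hβ).const_mul (4 * CC d)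
      rw [mul_zero] at this
      filter_upwards [this.eventually_lt_const (half_pos hε)] with n hn
      unfold tt
      linarith
    filter_upwards [e1, consist hα hβ hp (ε / 60) (by positivity), eventually_ge_atTop 3] with n h1 h2 h3
    obtain ⟨θ, hθ⟩ := h2
    refine le_trans (measure_mono ?_) (hV3 n h3 p hp _ θ hθ)
    intro xs hxs
    simp only [Set.mem_ofPred_eq] at hxs ⊢
    linarith
  · rintro p W Lt hW - - hLt - hp hpc ⟨CW, hCW⟩ ⟨CL, hCL⟩
    obtain ⟨c, hc, hev⟩ := rate hα hβ hp W Lt hW hLt hpc CW CL hCW hCL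
    refine ⟨10 * c + 4 * CC d, 1, ?_⟩
    refine tendsto_of_tendsto_of_tendsto_of_le_of_le' tendsto_const_nhds tendsto_two_div
      (Eventually.of_forall fun _ => zero_le) ?_
    filter_upwards [hev, eventually_ge_atTop 3] with n h2 h3
    obtain ⟨θ, hθ⟩ := h2
    refine le_trans (measure_mono ?_) (hV3 n h3 p hp _ θ hθ)
    intro xs hxs
    simp only [Set.mem_ofPred_eq, Real.rpow_one] at hxs ⊢
    refine lt_of_le_of_lt ?_ hxs
    have hn3 : (3 : ℝ) ≤ n := by exact_mod_cast h3
    have hl1 : 1 ≤ Real.log n := by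
      rw [Real.le_log_iff_exp_le (by linarith)]
      linarith [Real.exp_one_lt_d9]
    have hRp := RR_pos α β (n := n) (by omega)
    change 10 * (c * RR α β n) + 4 * tt α β d n ≤ (10 * c + 4 * CC d) * Real.log n * RR α β n
    have : c * RR α β n * 1 ≤ c * RR α β n * Real.log n :=
      mul_le_mul_of_nonneg_left hl1 (by positivity)
    unfold tt
    linarith
end
end

section
/- Let p : ℝ^d → ℝ be non-negative, compactly supported, bounded, and continuous at Lebesgue-almost every point, and let ε > 0. Then there exist k ∈ ℕ, weights w_1,…,w_k ≥ 0, and functions f_1,…,f_k ∈ ℱ^d (each f_i a product f_{i,1} × ⋯ × f_{i,d} of smooth Lipschitz continuous pdfs on ℝ) such that ∑_{i=1}^k w_i f_i ≤ p pointwise and ∫ ( p − ∑_{i=1}^k w_i f_i ) dλ ≤ ε. -/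
open MeasureTheory Filter Finset

noncomputable section

/-- Membership in `ℱ`: a smooth, Lipschitz continuous pdf on `ℝ`. -/
def IsSmoothLipPdf (f : ℝ → ℝ) : Prop :=
  ContDiff ℝ (⊤ : ℕ∞) f ∧ (∃ L : ℝ, 0 ≤ L ∧ ∀ x y, |f x - f y| ≤ L * |x - y|) ∧
  (∀ x, 0 ≤ f x) ∧ ∫ x, f x = 1

/-- Smooth bump on `[-1,1]` whose integer translates sum to one. -/
def bmp (t : ℝ) : ℝ := Real.smoothTransition (t + 1) - Real.smoothTransition t

lemma bmp_nonneg (t : ℝ) : 0 ≤ bmp t :=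
  sub_nonneg.2 (Real.smoothTransition.monotone (by linarith))

lemma bmp_contDiff : ContDiff ℝ (⊤ : ℕ∞) bmp :=
  (Real.smoothTransition.contDiff.comp (contDiff_id.add contDiff_const)).sub
    Real.smoothTransition.contDiff

lemma bmp_zero_of {t : ℝ} (h : 1 < |t|) : bmp t = 0 := by
  unfold bmp
  rcases lt_abs.1 h with h | h
  · rw [Real.smoothTransition.one_of_one_le (by linarith),
      Real.smoothTransition.one_of_one_le (by linarith), sub_self]
  · rw [Real.smoothTransition.zero_of_nonpos (by linarith),
      Real.smoothTransition.zero_of_nonpos (by linarith), sub_self]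

lemma bmp_compact : HasCompactSupport bmp := by
  refine HasCompactSupport.intro (isCompact_Icc (a := (-1:ℝ)) (b := 1)) ?_
  intro x hx
  apply bmp_zero_of
  by_contra h
  exact hx (abs_le.1 (not_lt.1 h))

lemma bmp_integral_pos : 0 < ∫ x, bmp x := by
  refine bmp_contDiff.continuous.integral_pos_of_hasCompactSupport_nonneg_nonzero (x := 0)
    bmp_compact bmp_nonneg ?_
  simp [bmp]

/-- The scaled translate. -/
def sb (n i : ℕ) (t : ℝ) : ℝ := bmp ((n + 1 : ℝ) * t - ((i : ℝ) - (n + 1 : ℝ) ^ 2))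

lemma sb_nonneg (n i : ℕ) (t : ℝ) : 0 ≤ sb n i t := bmp_nonneg _

lemma sb_contDiff (n i : ℕ) : ContDiff ℝ (⊤ : ℕ∞) (sb n i) := by
  unfold sb
  exact bmp_contDiff.comp ((contDiff_const.mul contDiff_id).sub contDiff_const)

lemma sb_compact (n i : ℕ) : HasCompactSupport (sb n i) := by
  have hn : (0 : ℝ) < n + 1 := by positivity
  set a : ℝ := (i : ℝ) - (n + 1 : ℝ) ^ 2 with ha
  refine HasCompactSupport.intro
    (isCompact_Icc (a := ((a - 1) / (n + 1 : ℝ))) (b := (a + 1) / (n + 1 : ℝ))) ?_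
  intro x hx
  apply bmp_zero_of
  by_contra h
  apply hx
  have := abs_le.1 (not_lt.1 h)
  constructor
  · rw [div_le_iff₀ hn]; linarith
  · rw [le_div_iff₀ hn]; linarith

lemma sb_integral (n i : ℕ) : ∫ x, sb n i x = (n + 1 : ℝ)⁻¹ * ∫ x, bmp x := by
  unfold sb
  have h1 := Measure.integral_comp_mul_left
    (fun y => bmp (y - ((i : ℝ) - (n + 1 : ℝ) ^ 2))) (n + 1 : ℝ)
  have h2 := integral_sub_right_eq_self (μ := (volume : Measure ℝ)) bmp
    ((i : ℝ) - (n + 1 : ℝ) ^ 2)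
  rw [h1, h2, abs_of_pos (by positivity), smul_eq_mul]

lemma sb_sum (n : ℕ) (t : ℝ) : ∑ i : Fin (2 * (n + 1) ^ 2 + 1), sb n i t =
    Real.smoothTransition ((n + 1 : ℝ) * t + (n + 1 : ℝ) ^ 2 + 1)
      - Real.smoothTransition ((n + 1 : ℝ) * t - (n + 1 : ℝ) ^ 2) := by
  rw [Fin.sum_univ_eq_sum_range (fun i => sb n i t)]
  have h := Finset.sum_range_sub' (fun i : ℕ => Real.smoothTransition
    ((n + 1 : ℝ) * t - ((i : ℝ) - (n + 1 : ℝ) ^ 2) + 1)) (2 * (n + 1) ^ 2 + 1)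
  have e : ∀ i : ℕ, sb n i t = Real.smoothTransition
    ((n + 1 : ℝ) * t - ((i : ℝ) - (n + 1 : ℝ) ^ 2) + 1) - Real.smoothTransition
    ((n + 1 : ℝ) * t - (((i + 1 : ℕ) : ℝ) - (n + 1 : ℝ) ^ 2) + 1) := by
    intro i
    unfold sb bmp
    congr 2
    push_cast; ring
  simp_rw [e]
  rw [h]
  congr 2
  · push_cast; ring
  · push_cast; ring

lemma sb_sum_le (n : ℕ) (t : ℝ) : ∑ i : Fin (2 * (n + 1) ^ 2 + 1), sb n i t ≤ 1 := by
  rw [sb_sum]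
  have := Real.smoothTransition.le_one ((n + 1 : ℝ) * t + (n + 1 : ℝ) ^ 2 + 1)
  have := Real.smoothTransition.nonneg ((n + 1 : ℝ) * t - (n + 1 : ℝ) ^ 2)
  linarith

lemma sb_sum_eq (n : ℕ) (t : ℝ) (h : |t| ≤ n + 1) :
    ∑ i : Fin (2 * (n + 1) ^ 2 + 1), sb n i t = 1 := by
  rw [sb_sum]
  have hn : (0 : ℝ) < n + 1 := by positivity
  obtain ⟨h1, h2⟩ := abs_le.1 h
  rw [Real.smoothTransition.one_of_one_le (by nlinarith),
    Real.smoothTransition.zero_of_nonpos (by nlinarith), sub_zero]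

/-- Index set of the grid. -/
abbrev Grid (d n : ℕ) := Fin d → Fin (2 * (n + 1) ^ 2 + 1)

/-- The cell around a grid point. -/
def cell (d n : ℕ) (k : Grid d n) : Set (Fin d → ℝ) :=
  {x | ∀ j, |(n + 1 : ℝ) * x j - (((k j : ℕ) : ℝ) - (n + 1 : ℝ) ^ 2)| ≤ 1}

/-- The lower approximation. -/
def lowc {d : ℕ} (p : (Fin d → ℝ) → ℝ) (n : ℕ) (k : Grid d n) : ℝ := sInf (p '' cell d n k)

def low {d : ℕ} (p : (Fin d → ℝ) → ℝ) (n : ℕ) (x : Fin d → ℝ) : ℝ :=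
  ∑ k : Grid d n, lowc p n k * ∏ j, sb n (k j) (x j)

lemma prod_sb_sum {d : ℕ} (n : ℕ) (x : Fin d → ℝ) :
    ∑ k : Grid d n, ∏ j, sb n (k j) (x j) =
      ∏ j, ∑ i : Fin (2 * (n + 1) ^ 2 + 1), sb n i (x j) := by
  rw [Finset.prod_univ_sum]
  simp

lemma mem_cell {d n : ℕ} (k : Grid d n) (x : Fin d → ℝ)
    (h : ∏ j, sb n (k j) (x j) ≠ 0) : x ∈ cell d n k := by
  intro j
  by_contra hj
  exact h (Finset.prod_eq_zero (Finset.mem_univ j) (bmp_zero_of (not_le.1 hj)))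

lemma cell_nonempty {d n : ℕ} (k : Grid d n) : (cell d n k).Nonempty := by
  have hn : (n + 1 : ℝ) ≠ 0 := by positivity
  refine ⟨fun j => (((k j : ℕ) : ℝ) - (n + 1 : ℝ) ^ 2) / (n + 1 : ℝ), fun j => ?_⟩
  rw [mul_div_cancel₀ _ hn]
  simp

lemma lowc_nonneg {d : ℕ} {p : (Fin d → ℝ) → ℝ} (hnn : ∀ x, 0 ≤ p x) (n : ℕ) (k : Grid d n) :
    0 ≤ lowc p n k := by
  apply Real.sInf_nonneg
  rintro _ ⟨x, _, rfl⟩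
  exact hnn x

lemma lowc_le {d : ℕ} {p : (Fin d → ℝ) → ℝ} (hnn : ∀ x, 0 ≤ p x) (n : ℕ) (k : Grid d n)
    {x : Fin d → ℝ} (hx : x ∈ cell d n k) : lowc p n k ≤ p x := by
  refine csInf_le ⟨0, ?_⟩ ⟨x, hx, rfl⟩
  rintro _ ⟨x, _, rfl⟩
  exact hnn x

lemma prod_nonneg' {d n : ℕ} (k : Grid d n) (x : Fin d → ℝ) : 0 ≤ ∏ j, sb n (k j) (x j) :=
  Finset.prod_nonneg fun _ _ => sb_nonneg _ _ _

lemma low_nonneg {d : ℕ} {p : (Fin d → ℝ) → ℝ} (hnn : ∀ x, 0 ≤ p x) (n : ℕ) (x : Fin d → ℝ) :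
    0 ≤ low p n x :=
  Finset.sum_nonneg fun k _ => mul_nonneg (lowc_nonneg hnn n k) (prod_nonneg' k x)

lemma low_le {d : ℕ} {p : (Fin d → ℝ) → ℝ} (hnn : ∀ x, 0 ≤ p x) (n : ℕ) (x : Fin d → ℝ) :
    low p n x ≤ p x := by
  calc low p n x ≤ ∑ k : Grid d n, p x * ∏ j, sb n (k j) (x j) := by
        refine Finset.sum_le_sum fun k _ => ?_
        by_cases h : ∏ j, sb n (k j) (x j) = 0
        · simp [h]
        · exact mul_le_mul_of_nonneg_right (lowc_le hnn n k (mem_cell k x h)) (prod_nonneg' k x)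
    _ = p x * ∏ j, ∑ i : Fin (2 * (n + 1) ^ 2 + 1), sb n i (x j) := by
        rw [← Finset.mul_sum, prod_sb_sum]
    _ ≤ p x * 1 := by
        refine mul_le_mul_of_nonneg_left ?_ (hnn x)
        exact Finset.prod_le_one (fun j _ => Finset.sum_nonneg fun _ _ => sb_nonneg _ _ _)
          (fun j _ => sb_sum_le n (x j))
    _ = p x := mul_one _

lemma low_continuous {d : ℕ} (p : (Fin d → ℝ) → ℝ) (n : ℕ) : Continuous (low p n) := by
  unfold low
  refine continuous_finsetSum _ fun k _ => continuous_const.mul ?_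
  refine continuous_finsetProd _ fun j _ => ?_
  exact (sb_contDiff n (k j)).continuous.comp (continuous_apply j)

lemma low_tendsto {d : ℕ} {p : (Fin d → ℝ) → ℝ} (hnn : ∀ x, 0 ≤ p x)
    {x : Fin d → ℝ} (hx : ContinuousAt p x) :
    Tendsto (fun n => p x - low p n x) atTop (nhds 0) := by
  rw [Metric.tendsto_atTop]
  intro δ hδ
  obtain ⟨r, hr, hpr⟩ := Metric.continuousAt_iff.1 hx (δ / 2) (half_pos hδ)
  obtain ⟨N1, hN1⟩ := exists_nat_gt (2 / r)
  obtain ⟨N2, hN2⟩ := exists_nat_gt ‖x‖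
  refine ⟨max N1 N2, fun n hn => ?_⟩
  have hn1 : (N1 : ℝ) ≤ n := by exact_mod_cast (le_max_left _ _).trans hn
  have hn2 : (N2 : ℝ) ≤ n := by exact_mod_cast (le_max_right _ _).trans hn
  have hpos : (0 : ℝ) < n + 1 := by positivity
  have h2r : 2 < r * (n + 1 : ℝ) := by
    have : 2 / r < n + 1 := by linarith
    rw [div_lt_iff₀ hr] at this
    linarith
  have hone : ∑ k : Grid d n, ∏ j, sb n (k j) (x j) = 1 := by
    rw [prod_sb_sum]
    refine Finset.prod_eq_one fun j _ => sb_sum_eq n (x j) ?_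
    have := norm_le_pi_norm x j
    rw [Real.norm_eq_abs] at this
    linarith
  have key : p x - δ / 2 ≤ low p n x := by
    calc p x - δ / 2 = ∑ k : Grid d n, (p x - δ / 2) * ∏ j, sb n (k j) (x j) := by
          rw [← Finset.mul_sum, hone, mul_one]
      _ ≤ low p n x := by
          refine Finset.sum_le_sum fun k _ => ?_
          by_cases h : ∏ j, sb n (k j) (x j) = 0
          · simp [h]
          · refine mul_le_mul_of_nonneg_right ?_ (prod_nonneg' k x)
            have hxc := mem_cell k x h
            refine le_csInf ((cell_nonempty k).image p) ?_
            rintro _ ⟨y, hy, rfl⟩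
            have hd : dist y x < r := by
              rw [dist_pi_lt_iff hr]
              intro j
              rw [Real.dist_eq]
              have a1 := abs_le.1 (hxc j)
              have a2 := abs_le.1 (hy j)
              rw [abs_lt]
              constructor
              · nlinarith
              · nlinarith
            have := hpr hd
            rw [Real.dist_eq, abs_lt] at this
            linarith
  have := low_le hnn n x
  rw [Real.dist_eq, sub_zero, abs_lt]
  constructor <;> linarith

/-- The normalised pdf. -/
def npdf (n i : ℕ) (t : ℝ) : ℝ := ((n + 1 : ℝ) * (∫ x, bmp x)⁻¹) * sb n i t

lemma npdf_is (n i : ℕ) : IsSmoothLipPdf (npdf n i) := by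
  have hc := bmp_integral_pos
  have hn : (0 : ℝ) < n + 1 := by positivity
  have hs : ContDiff ℝ (⊤ : ℕ∞) (npdf n i) := contDiff_const.mul (sb_contDiff n i)
  refine ⟨hs, ?_, ?_, ?_⟩
  · have hcs : HasCompactSupport (npdf n i) := (sb_compact n i).mul_left
    obtain ⟨C, hC⟩ := ContDiff.lipschitzWith_of_hasCompactSupport hcs hs (by simp)
    refine ⟨C, C.2, fun x y => ?_⟩
    have := hC.dist_le_mul x y
    rwa [Real.dist_eq, Real.dist_eq] at this
  · intro x
    exact mul_nonneg (by positivity) (sb_nonneg n i x)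
  · unfold npdf
    rw [integral_const_mul, sb_integral]
    field_simp

/-- **Lemma 7.** A non-negative, compactly supported, bounded, a.e. continuous function
can be approximated from below, arbitrarily well in `L¹`, by an element of `cone(ℱ^d)`. -/
theorem cone_approx_from_below
    (d : ℕ) (hd : 1 ≤ d) (p : (Fin d → ℝ) → ℝ)
    (hmeas : Measurable p) (hnn : ∀ x, 0 ≤ p x)
    (hsupp : HasCompactSupport p) (hbdd : ∃ M : ℝ, ∀ x, p x ≤ M)
    (hcont : ∀ᵐ x ∂(volume : Measure (Fin d → ℝ)), ContinuousAt p x)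
    (ε : ℝ) (hε : 0 < ε) :
    ∃ (k : ℕ), 1 ≤ k ∧
      ∃ (w : Fin k → ℝ) (f : Fin k → Fin d → ℝ → ℝ),
        (∀ i, 0 ≤ w i) ∧ (∀ i j, IsSmoothLipPdf (f i j)) ∧
        (∀ x : Fin d → ℝ, ∑ i, w i * ∏ j, f i j (x j) ≤ p x) ∧
        ∫ x : Fin d → ℝ, (p x - ∑ i, w i * ∏ j, f i j (x j)) ≤ ε := by
  obtain ⟨M, hM⟩ := hbdd
  have hint : Integrable p := by
    have hon : IntegrableOn p (tsupport p) := by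
      refine Measure.integrableOn_of_bounded (M := M) hsupp.measure_lt_top.ne
        hmeas.aestronglyMeasurable ?_
      refine Eventually.of_forall fun x => ?_
      rw [Real.norm_eq_abs, abs_of_nonneg (hnn x)]
      exact hM x
    exact (integrableOn_iff_integrable_of_support_subset (subset_tsupport p)).1 hon
  have hlim : Tendsto (fun n => ∫ x, (p x - low p n x)) atTop (nhds (∫ _ : Fin d → ℝ, (0 : ℝ))) := by
    refine tendsto_integral_of_dominated_convergence p ?_ hint ?_ ?_
    · intro n
      exact (hmeas.sub (low_continuous p n).measurable).aestronglyMeasurable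
    · intro n
      refine Eventually.of_forall fun x => ?_
      have h1 := low_le hnn n x
      have h2 := low_nonneg hnn n x
      rw [Real.norm_eq_abs, abs_of_nonneg (by linarith)]
      linarith
    · filter_upwards [hcont] with x hx
      exact low_tendsto hnn hx
  rw [integral_zero] at hlim
  obtain ⟨n, hn⟩ := (hlim.eventually_le_const hε).exists
  have hc := bmp_integral_pos
  have hn1 : (0 : ℝ) < n + 1 := by positivity
  let e : Fin (Fintype.card (Grid d n)) ≃ Grid d n := (Fintype.equivFin _).symm
  have hsum : ∀ x : Fin d → ℝ, ∑ i, (lowc p n (e i) * (((n + 1 : ℝ) * (∫ x, bmp x)⁻¹) ^ d)⁻¹) *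
      ∏ j, npdf n (e i j) (x j) = low p n x := by
    intro x
    rw [low, ← e.sum_comp]
    refine Finset.sum_congr rfl fun i _ => ?_
    unfold npdf
    rw [Finset.prod_mul_distrib, Finset.prod_const, Finset.card_univ, Fintype.card_fin, mul_assoc,
      inv_mul_cancel_left₀ (by positivity)]
  refine ⟨Fintype.card (Grid d n), Fintype.card_pos,
    fun i => lowc p n (e i) * (((n + 1 : ℝ) * (∫ x, bmp x)⁻¹) ^ d)⁻¹,
    fun i j => npdf n (e i j), ?_, ?_, ?_, ?_⟩
  · intro i
    exact mul_nonneg (lowc_nonneg hnn n _) (by positivity)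
  · intro i j
    exact npdf_is n _
  · intro x
    rw [hsum]
    exact low_le hnn n x
  · simp_rw [hsum]
    exact hn
end
end

section
/- Let p : ℝ^d → ℝ be non-negative, compactly supported, bounded, and continuous at Lebesgue-almost every point. Then there exist a non-negative sequence (w_i)_{i=1}^∞ and a sequence (f_i)_{i=1}^∞ of elements of ℱ^d such that p = ∑_{i=1}^∞ w_i f_i, with the series converging in L¹(λ) (indeed absolutely summable in L¹) and the equality holding almost everywhere. -/
open MeasureTheory Filter Finset

noncomputable section

lemma exists_beta : ∃ (β : ℝ → ℝ) (B C : ℝ), ContDiff ℝ (⊤ : ℕ∞) β ∧ 1 ≤ B ∧ 0 ≤ C ∧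
    (∀ x y, |β x - β y| ≤ C * |x - y|) ∧ (∀ x, 0 ≤ β x) ∧ ∫ x, β x = 1 ∧
    Integrable β ∧ (∀ x, β x ≤ B * (Set.Ico (0:ℝ) 1).indicator 1 x) := by
  let b : ContDiffBump (1/2 : ℝ) := ⟨1/4, 1/2, by norm_num, by norm_num⟩
  have hs : ContDiff ℝ (⊤ : ℕ∞) (b.normed volume) := b.contDiff_normed
  have hc : HasCompactSupport (b.normed volume) := b.hasCompactSupport_normed
  obtain ⟨C, hC⟩ := ContDiff.lipschitzWith_of_hasCompactSupport hc hs (by simp)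
  obtain ⟨B, hB⟩ := hc.exists_bound_of_continuous hs.continuous
  refine ⟨b.normed volume, max B 1, C, hs, le_max_right _ _, C.2, ?_, fun x => b.nonneg_normed x,
    b.integral_normed, b.integrable_normed, ?_⟩
  · intro x y
    simpa [Real.dist_eq] using hC.dist_le_mul x y
  · intro x
    by_cases hx : x ∈ Set.Ico (0:ℝ) 1
    · simp only [Set.indicator_of_mem hx, Pi.one_apply, mul_one]
      exact (le_abs_self _).trans ((hB x).trans (le_max_left _ _))
    · simp only [Set.indicator_of_notMem hx, mul_zero]
      have : x ∉ Function.support (b.normed volume) := by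
        rw [b.support_normed_eq, Metric.mem_ball, Real.dist_eq, abs_lt]
        rintro ⟨h1, h2⟩
        change -(1/2) < _ at h1
        change _ < (1/2 : ℝ) at h2
        exact hx ⟨by linarith, by linarith⟩
      exact (Function.notMem_support.1 this).le

lemma int_scale {g : ℝ → ℝ} (hg : ∫ x, g x = 1) {N : ℝ} (hN : 0 < N) (c : ℝ) :
    ∫ t, N * g (N * t - c) = 1 := by
  rw [integral_const_mul, Measure.integral_comp_mul_left (fun t => g (t - c)),
    integral_sub_right_eq_self, hg, abs_of_pos (inv_pos.2 hN)]
  simp [hN.ne']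

lemma integrable_scale {g : ℝ → ℝ} (hg : Integrable g) {N : ℝ} (hN : 0 < N) (c : ℝ) :
    Integrable (fun t => N * g (N * t - c)) :=
  (((hg.comp_sub_right c).comp_mul_left' hN.ne')).const_mul N

lemma int_prod {d : ℕ} {g : ℝ → ℝ} (hg : ∫ x, g x = 1) {N : ℝ} (hN : 0 < N) (c : Fin d → ℝ) :
    ∫ x : Fin d → ℝ, ∏ j, (N * g (N * x j - c j)) = 1 := by
  rw [integral_fintype_prod_volume_eq_prod (fun j t => N * g (N * t - c j))]
  simp [int_scale hg hN]

lemma integrable_prod_scale {d : ℕ} {g : ℝ → ℝ} (hg : Integrable g) {N : ℝ} (hN : 0 < N)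
    (c : Fin d → ℝ) :
    Integrable (fun x : Fin d → ℝ => ∏ j, (N * g (N * x j - c j))) :=
  Integrable.fintype_prod (fun j => integrable_scale hg hN (c j))

/-- infimum over a grid cube -/
def cubeInf {d : ℕ} (r : (Fin d → ℝ) → ℝ) (N : ℝ) (k : Fin d → ℤ) : ℝ :=
  ⨅ y : {y : Fin d → ℝ // ∀ j, ⌊N * y j⌋ = k j}, r y

lemma cubeInf_le {d : ℕ} {r : (Fin d → ℝ) → ℝ} (hr : ∀ x, 0 ≤ r x) (N : ℝ) (k : Fin d → ℤ)
    (y : Fin d → ℝ) (hy : ∀ j, ⌊N * y j⌋ = k j) : cubeInf r N k ≤ r y :=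
  ciInf_le (f := fun y : {y : Fin d → ℝ // ∀ j, ⌊N * y j⌋ = k j} => r y)
    ⟨0, by rintro _ ⟨y, rfl⟩; exact hr _⟩ ⟨y, hy⟩

lemma cubeInf_nonneg {d : ℕ} {r : (Fin d → ℝ) → ℝ} (hr : ∀ x, 0 ≤ r x) (N : ℝ) (k : Fin d → ℤ) :
    0 ≤ cubeInf r N k := Real.iInf_nonneg (fun _ => hr _)

lemma cubeInf_finite {d : ℕ} {r : (Fin d → ℝ) → ℝ} (hr : ∀ x, 0 ≤ r x)
    (hc : HasCompactSupport r) {N : ℝ} (hN : 0 < N) :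
    {k : Fin d → ℤ | cubeInf r N k ≠ 0}.Finite := by
  obtain ⟨R, hR⟩ := hc.isCompact.isBounded.subset_closedBall 0
  refine (Set.finite_Icc (fun _ : Fin d => -⌈N * R⌉) (fun _ => ⌈N * R⌉)).subset ?_
  intro k hk
  have h1 : cubeInf r N k ≤ r (fun j => k j / N) :=
    cubeInf_le hr N k _ (fun j => by rw [mul_div_cancel₀ _ hN.ne']; simp)
  have h2 : r (fun j => k j / N) ≠ 0 := by
    have := lt_of_le_of_ne (cubeInf_nonneg hr N k) (Ne.symm hk)
    exact (this.trans_le h1).ne'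
  have h3 := hR (subset_tsupport _ h2)
  rw [mem_closedBall_zero_iff] at h3
  have h4 : ∀ j, |(k j : ℝ)| ≤ ⌈N * R⌉ := by
    intro j
    have := (norm_le_pi_norm _ j).trans h3
    rw [Real.norm_eq_abs, abs_div, abs_of_pos hN, div_le_iff₀ hN] at this
    exact (this.trans_eq (mul_comm _ _)).trans (Int.le_ceil _)
  constructor <;> intro j <;> have := abs_le.1 (h4 j)
  · exact_mod_cast this.1
  · exact_mod_cast this.2

lemma cubeInf_tendsto {d : ℕ} {r : (Fin d → ℝ) → ℝ} (hr : ∀ x, 0 ≤ r x) (x : Fin d → ℝ)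
    (hx : ContinuousAt r x) :
    Tendsto (fun n : ℕ => cubeInf r (n + 1) (fun j => ⌊((n:ℝ) + 1) * x j⌋)) atTop (nhds (r x)) := by
  rw [Metric.tendsto_atTop]
  intro ε hε
  obtain ⟨δ, hδ, h⟩ := Metric.continuousAt_iff.1 hx (ε / 2) (by positivity)
  obtain ⟨n0, hn0⟩ := exists_nat_one_div_lt hδ
  refine ⟨n0, fun n hn => ?_⟩
  have hN : (0:ℝ) < n + 1 := by positivity
  have hle := cubeInf_le hr (n + 1) (fun j => ⌊((n:ℝ) + 1) * x j⌋) x (fun _ => rfl)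
  have hge : r x - ε / 2 ≤ cubeInf r (n + 1) (fun j => ⌊((n:ℝ) + 1) * x j⌋) := by
    have : Nonempty {y : Fin d → ℝ // ∀ j, ⌊((n:ℝ) + 1) * y j⌋ = ⌊((n:ℝ) + 1) * x j⌋} :=
      ⟨⟨x, fun _ => rfl⟩⟩
    refine le_ciInf ?_
    rintro ⟨y, hy⟩
    have hd : dist y x < δ := by
      rw [dist_pi_lt_iff hδ]
      intro j
      have h1 := Int.abs_sub_lt_one_of_floor_eq_floor (hy j)
      rw [← mul_sub, abs_mul, abs_of_pos hN] at h1
      rw [Real.dist_eq]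
      have h2 : (n0:ℝ) + 1 ≤ n + 1 := by exact_mod_cast Nat.succ_le_succ hn
      have h3 : |y j - x j| < 1 / ((n:ℝ) + 1) := by
        rw [lt_div_iff₀ hN, mul_comm]; exact h1
      exact h3.trans_le ((one_div_le_one_div_of_le (by positivity) h2).trans hn0.le)
    have := h hd
    rw [Real.dist_eq, abs_lt] at this
    simp only
    linarith [this.1]
  rw [Real.dist_eq, abs_lt]
  constructor <;> linarith

def Good {d : ℕ} (r : (Fin d → ℝ) → ℝ) : Prop :=
  (∀ x, 0 ≤ r x) ∧ Integrable r ∧ HasCompactSupport r ∧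
    ∀ᵐ x ∂(volume : Measure (Fin d → ℝ)), ContinuousAt r x

lemma prod_ind {d : ℕ} (N : ℝ) (k : Fin d → ℤ) (x : Fin d → ℝ) :
    ∏ j, (Set.Ico (0:ℝ) 1).indicator (1 : ℝ → ℝ) (N * x j - k j) =
      if k = (fun j => ⌊N * x j⌋) then 1 else 0 := by
  have key : ∀ j, N * x j - k j ∈ Set.Ico (0:ℝ) 1 ↔ k j = ⌊N * x j⌋ := by
    intro j
    rw [eq_comm, Int.floor_eq_iff, Set.mem_Ico]
    constructor <;> rintro ⟨h1, h2⟩ <;> constructor <;> linarith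
  split_ifs with h
  · refine Finset.prod_eq_one fun j _ => ?_
    rw [Set.indicator_of_mem ((key j).2 (congrFun h j))]; rfl
  · obtain ⟨j, hj⟩ := Function.ne_iff.1 h
    refine Finset.prod_eq_zero (Finset.mem_univ j) ?_
    rw [Set.indicator_of_notMem (fun hmem => hj ((key j).1 hmem))]

lemma step (d : ℕ) : ∃ q : ℝ, 0 ≤ q ∧ q < 1 ∧ ∀ r : (Fin d → ℝ) → ℝ, Good r →
    ∃ (F : Finset (Fin d → ℤ)) (a : (Fin d → ℤ) → ℝ) (f : (Fin d → ℤ) → Fin d → ℝ → ℝ),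
      (∀ k, 0 ≤ a k) ∧ (∀ k j, IsSmoothLipPdf (f k j)) ∧
      (Good fun x => r x - ∑ k ∈ F, a k * ∏ j, f k j (x j)) ∧
      (∫ x, (r x - ∑ k ∈ F, a k * ∏ j, f k j (x j)) = (∫ x, r x) - ∑ k ∈ F, a k) ∧
      ∫ x, (r x - ∑ k ∈ F, a k * ∏ j, f k j (x j)) ≤ q * ∫ x, r x := by
  obtain ⟨β, B, C, hβs, hB, hC, hβL, hβ0, hβ1, hβi, hβB⟩ := exists_beta
  have hB0 : 0 < B := by linarith
  have hBd : 1 ≤ B ^ d := one_le_pow₀ hB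
  refine ⟨1 - (B ^ d)⁻¹ / 2, ?_, ?_, ?_⟩
  · have := inv_le_one_of_one_le₀ hBd
    linarith
  · have : 0 < (B ^ d)⁻¹ := by positivity
    linarith
  rintro r ⟨hr0, hri, hrc, hrcont⟩
  set J : ℝ → ℝ := (Set.Ico (0:ℝ) 1).indicator 1 with hJ
  have hJi : Integrable J := by
    rw [hJ, integrable_indicator_iff measurableSet_Ico]
    exact integrableOn_const (by simp)
  have hJ1 : ∫ x, J x = 1 := by
    rw [hJ, integral_indicator measurableSet_Ico]; simp
  have hfin : ∀ n : ℕ, {k : Fin d → ℤ | cubeInf r ((n:ℝ)+1) k ≠ 0}.Finite := fun n =>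
    cubeInf_finite hr0 hrc (by positivity)
  let F : ℕ → Finset (Fin d → ℤ) := fun n => (hfin n).toFinset
  let L : ℕ → (Fin d → ℝ) → ℝ := fun n x =>
    ∑ k ∈ F n, cubeInf r ((n:ℝ)+1) k * ∏ j, J (((n:ℝ)+1) * x j - k j)
  have hL : ∀ n x, L n x = cubeInf r ((n:ℝ)+1) (fun j => ⌊((n:ℝ) + 1) * x j⌋) := by
    intro n x
    simp only [L, hJ, prod_ind, mul_ite, mul_one, mul_zero, Finset.sum_ite_eq']
    split_ifs with h
    · rfl
    · simp only [F, Set.Finite.mem_toFinset, Set.mem_ofPred_eq, not_not] at h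
      exact h.symm
  have hLr : ∀ n x, L n x ≤ r x := fun n x => by
    rw [hL]; exact cubeInf_le hr0 _ _ _ (fun _ => rfl)
  have hL0 : ∀ n x, 0 ≤ L n x := fun n x => by
    rw [hL]; exact cubeInf_nonneg hr0 _ _
  have hJprod : ∀ (n : ℕ) (k : Fin d → ℤ) (x : Fin d → ℝ), ∏ j, J (((n:ℝ)+1) * x j - k j) =
      ((((n:ℝ)+1))^d)⁻¹ * ∏ j, (((n:ℝ)+1) * J (((n:ℝ)+1) * x j - k j)) := by
    intro n k x
    have : (((n:ℝ)+1))^d ≠ 0 := by positivity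
    rw [Finset.prod_mul_distrib]; simp; field_simp
  have hLint : ∀ n, Integrable (L n) := by
    intro n
    refine integrable_finsetSum _ fun k _ => Integrable.const_mul ?_ _
    simp only [hJprod]
    exact (integrable_prod_scale hJi (by positivity) (fun j => (k j : ℝ))).const_mul _
  have hLI : ∀ n, ∫ x, L n x = ∑ k ∈ F n, cubeInf r ((n:ℝ)+1) k * ((((n:ℝ)+1))^d)⁻¹ := by
    intro n
    simp only [L]
    rw [integral_finsetSum]
    · refine Finset.sum_congr rfl fun k _ => ?_
      rw [integral_const_mul]
      simp only [hJprod]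
      rw [integral_const_mul, int_prod hJ1 (by positivity) (fun j => (k j : ℝ)), mul_one]
    · intro k _
      refine Integrable.const_mul ?_ _
      simp only [hJprod]
      exact (integrable_prod_scale hJi (by positivity) (fun j => (k j : ℝ))).const_mul _
  have hlim : Tendsto (fun n => ∫ x, L n x) atTop (nhds (∫ x, r x)) := by
    refine tendsto_integral_of_dominated_convergence r (fun n => (hLint n).1) hri ?_ ?_
    · intro n
      exact Eventually.of_forall fun x => by
        rw [Real.norm_eq_abs, abs_of_nonneg (hL0 n x)]; exact hLr n x
    · filter_upwards [hrcont] with x hx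
      simp only [hL]
      exact cubeInf_tendsto hr0 x hx
  have hn : ∃ n, (∫ x, r x) / 2 ≤ ∫ x, L n x := by
    have h00 : 0 ≤ ∫ x, r x := integral_nonneg hr0
    rcases h00.eq_or_lt with h | h
    · refine ⟨0, ?_⟩
      have : 0 ≤ ∫ x, L 0 x := integral_nonneg (hL0 0)
      linarith
    · exact ((hlim.eventually (lt_mem_nhds (half_lt_self h))).exists).imp fun n h => h.le
  obtain ⟨n, hn⟩ := hn
  have hN : (0:ℝ) < n + 1 := by positivity
  set N : ℝ := n + 1 with hNdef
  let a : (Fin d → ℤ) → ℝ := fun k => cubeInf r N k * (N ^ d)⁻¹ * (B ^ d)⁻¹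
  let f : (Fin d → ℤ) → Fin d → ℝ → ℝ := fun k j t => N * β (N * t - k j)
  have ha : ∀ k, 0 ≤ a k := fun k => by
    have := cubeInf_nonneg hr0 N k
    positivity
  have hf : ∀ k j, IsSmoothLipPdf (f k j) := by
    intro k j
    refine ⟨?_, ⟨N * C * N, by positivity, ?_⟩, ?_, int_scale hβ1 hN _⟩
    · exact contDiff_const.mul (hβs.comp ((contDiff_const.mul contDiff_id).sub contDiff_const))
    · intro x y
      simp only [f]
      rw [← mul_sub, abs_mul, abs_of_pos hN]
      have := hβL (N * x - k j) (N * y - k j)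
      rw [sub_sub_sub_cancel_right, ← mul_sub, abs_mul, abs_of_pos hN] at this
      calc _ ≤ N * (C * (N * |x - y|)) := by gcongr
        _ = _ := by ring
    · intro x; exact mul_nonneg hN.le (hβ0 _)
  have hfi : ∀ k, Integrable (fun x : Fin d → ℝ => a k * ∏ j, f k j (x j)) := fun k =>
    (integrable_prod_scale hβi hN (fun j => (k j : ℝ))).const_mul _
  have hsi : Integrable (fun x : Fin d → ℝ => ∑ k ∈ F n, a k * ∏ j, f k j (x j)) :=
    integrable_finsetSum _ fun k _ => hfi k
  have hsI : ∫ x : Fin d → ℝ, ∑ k ∈ F n, a k * ∏ j, f k j (x j) = ∑ k ∈ F n, a k := by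
    rw [integral_finsetSum _ fun k _ => hfi k]
    refine Finset.sum_congr rfl fun k _ => ?_
    rw [integral_const_mul, int_prod hβ1 hN (fun j => (k j : ℝ)), mul_one]
  have hs0 : ∀ x : Fin d → ℝ, 0 ≤ ∑ k ∈ F n, a k * ∏ j, f k j (x j) := fun x =>
    Finset.sum_nonneg fun k _ => mul_nonneg (ha k) (Finset.prod_nonneg fun j _ => (hf k j).2.2.1 _)
  have hsr : ∀ x : Fin d → ℝ, ∑ k ∈ F n, a k * ∏ j, f k j (x j) ≤ r x := by
    intro x
    refine le_trans ?_ (hLr n x)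
    refine Finset.sum_le_sum fun k _ => ?_
    have h1 : ∏ j, f k j (x j) ≤ ∏ j, (N * (B * J (N * x j - k j))) := by
      refine Finset.prod_le_prod (fun j _ => (hf k j).2.2.1 _) fun j _ => ?_
      exact mul_le_mul_of_nonneg_left (hβB _) hN.le
    have h2 : ∏ j, (N * (B * J (N * x j - k j))) = N ^ d * B ^ d * ∏ j, J (N * x j - k j) := by
      simp [Finset.prod_mul_distrib, mul_assoc]
    calc a k * ∏ j, f k j (x j) ≤ a k * (N ^ d * B ^ d * ∏ j, J (N * x j - k j)) :=
          mul_le_mul_of_nonneg_left (h1.trans_eq h2) (ha k)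
      _ = _ := by
        simp only [a]
        have : N ^ d ≠ 0 := by positivity
        have : B ^ d ≠ 0 := by positivity
        field_simp
        rfl
  have hI : ∫ x, (r x - ∑ k ∈ F n, a k * ∏ j, f k j (x j)) = (∫ x, r x) - ∑ k ∈ F n, a k := by
    rw [integral_sub hri hsi, hsI]
  refine ⟨F n, a, f, ha, hf, ⟨fun x => sub_nonneg.2 (hsr x), hri.sub hsi, ?_, ?_⟩, hI, ?_⟩
  · refine hrc.mono fun x hx => ?_
    rw [Function.mem_support] at hx ⊢
    intro h
    apply hx
    have := hs0 x
    have := hsr x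
    linarith
  · filter_upwards [hrcont] with x hx
    refine hx.sub (Continuous.continuousAt ?_)
    refine continuous_finsetSum _ fun k _ => continuous_const.mul
      (continuous_finsetProd _ fun j _ => ?_)
    exact (hf k j).1.continuous.comp (continuous_apply j)
  · rw [hI]
    have : ∑ k ∈ F n, a k = (B ^ d)⁻¹ * ∫ x, L n x := by
      rw [hLI, Finset.mul_sum]
      refine Finset.sum_congr rfl fun k _ => ?_
      simp only [a]; ring
    rw [this]
    have hb : 0 < (B ^ d)⁻¹ := by positivity
    nlinarith [mul_le_mul_of_nonneg_left hn hb.le]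

/-- **Lemma 8.** A non-negative, compactly supported, bounded, a.e. continuous function
equals an infinite non-negative combination of elements of `ℱ^d`, the series being
absolutely summable in `L¹` and converging to `p` in `L¹` and a.e. -/
theorem compact_decomposition
    (d : ℕ) (hd : 1 ≤ d) (p : (Fin d → ℝ) → ℝ)
    (hmeas : Measurable p) (hnn : ∀ x, 0 ≤ p x)
    (hsupp : HasCompactSupport p) (hbdd : ∃ M : ℝ, ∀ x, p x ≤ M)
    (hcont : ∀ᵐ x ∂(volume : Measure (Fin d → ℝ)), ContinuousAt p x) :
    ∃ (w : ℕ → ℝ) (f : ℕ → Fin d → ℝ → ℝ),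
      (∀ i, 0 ≤ w i) ∧ (∀ i j, IsSmoothLipPdf (f i j)) ∧
      -- absolute summability in L¹ (each `w i * ∏ⱼ f i j` has L¹-norm `w i`)
      Summable w ∧
      (∀ᵐ x ∂(volume : Measure (Fin d → ℝ)), p x = ∑' i, w i * ∏ j, f i j (x j)) ∧
      Tendsto (fun N => ∫ x, |p x - ∑ i ∈ range N, w i * ∏ j, f i j (x j)|)
        atTop (nhds 0) := by
  obtain ⟨q, hq0, hq1, hstep⟩ := step d
  have hpi : Integrable p := by
    obtain ⟨M, hM⟩ := hbdd
    have hb : IntegrableOn p (tsupport p) :=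
      Measure.integrableOn_of_bounded (M := M) hsupp.isCompact.measure_lt_top.ne
        hmeas.aestronglyMeasurable
        (Eventually.of_forall fun x => by rw [Real.norm_eq_abs, abs_of_nonneg (hnn x)]; exact hM x)
    exact (integrableOn_iff_integrable_of_support_subset (subset_tsupport p)).1 hb
  have hpG : Good p := ⟨hnn, hpi, hsupp, hcont⟩
  choose F a f ha hf hG hI hq using fun r : {r : (Fin d → ℝ) → ℝ // Good r} => hstep r.1 r.2
  let R : ℕ → {r : (Fin d → ℝ) → ℝ // Good r} := fun n =>
    Nat.rec ⟨p, hpG⟩ (fun _ r => ⟨_, hG r⟩) n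
  let s : ℕ → (Fin d → ℝ) → ℝ := fun n x => ∑ k ∈ F (R n), a (R n) k * ∏ j, f (R n) k j (x j)
  have hR : ∀ n x, (R n).1 x = p x - ∑ m ∈ range n, s m x := by
    intro n x
    induction n with
    | zero => simp [R]
    | succ n ih =>
      rw [Finset.sum_range_succ, ← sub_sub, ← ih]
  have hRI : ∀ n, ∫ x, (R n).1 x = (∫ x, p x) - ∑ m ∈ range n, ∑ k ∈ F (R m), a (R m) k := by
    intro n
    induction n with
    | zero => simp [R]
    | succ n ih =>
      rw [Finset.sum_range_succ, ← sub_sub, ← ih]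
      exact hI (R n)
  have hRq : ∀ n, ∫ x, (R n).1 x ≤ q ^ n * ∫ x, p x := by
    intro n
    induction n with
    | zero => simp [R]
    | succ n ih =>
      calc _ ≤ q * ∫ x, (R n).1 x := hq (R n)
        _ ≤ q * (q ^ n * ∫ x, p x) := by gcongr
        _ = _ := by ring
  -- the double-indexed family
  let W : ℕ × (Fin d → ℤ) → ℝ := fun i => if i.2 ∈ F (R i.1) then a (R i.1) i.2 else 0
  let G : ℕ × (Fin d → ℤ) → Fin d → ℝ → ℝ := fun i => f (R i.1) i.2
  let T : ℕ × (Fin d → ℤ) → (Fin d → ℝ) → ℝ := fun i x => W i * ∏ j, G i j (x j)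
  have hW0 : ∀ i, 0 ≤ W i := by
    intro i
    simp only [W]
    split_ifs
    · exact ha _ _
    · exact le_rfl
  have hGp : ∀ i j, IsSmoothLipPdf (G i j) := fun i j => hf _ _ _
  have hT0 : ∀ i x, 0 ≤ T i x := fun i x =>
    mul_nonneg (hW0 i) (Finset.prod_nonneg fun j _ => (hGp i j).2.2.1 _)
  have hTin : ∀ n x, HasSum (fun k => T (n, k) x) (s n x) := by
    intro n x
    have h1 : HasSum (fun k => T (n, k) x) (∑ k ∈ F (R n), T (n, k) x) :=
      hasSum_sum_of_ne_finset_zero fun k hk => by simp [T, W, hk]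
    convert h1 using 1
    exact Finset.sum_congr rfl fun k hk => by simp [T, W, G, hk]
  have hWin : ∀ n, HasSum (fun k => W (n, k)) (∑ k ∈ F (R n), a (R n) k) := by
    intro n
    have h1 : HasSum (fun k => W (n, k)) (∑ k ∈ F (R n), W (n, k)) :=
      hasSum_sum_of_ne_finset_zero fun k hk => by simp [W, hk]
    convert h1 using 1
    exact Finset.sum_congr rfl fun k hk => by simp [W, hk]
  have hs0 : ∀ n x, 0 ≤ s n x := fun n x => (hTin n x).nonneg fun k => hT0 _ _
  have hsle : ∀ n x, ∑ m ∈ range n, s m x ≤ p x := by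
    intro n x
    have := (R n).2.1 x
    rw [hR] at this
    linarith
  have hssum : ∀ x, Summable (fun n => s n x) := fun x =>
    summable_of_sum_range_le (fun n => hs0 n x) (fun n => hsle n x)
  have hTsum : ∀ x, Summable (fun i => T i x) := by
    intro x
    refine (summable_prod_of_nonneg fun i => hT0 i x).2 ⟨fun n => (hTin n x).summable, ?_⟩
    simp only [(hTin _ x).tsum_eq]
    exact hssum x
  have hTtsum : ∀ x, ∑' i, T i x = ∑' n, s n x := by
    intro x
    rw [(hTsum x).tsum_prod' fun n => (hTin n x).summable]
    simp only [(hTin _ x).tsum_eq]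
  have hWsum : Summable W := by
    refine (summable_prod_of_nonneg hW0).2 ⟨fun n => (hWin n).summable, ?_⟩
    simp only [(hWin _).tsum_eq]
    refine summable_of_sum_range_le (c := ∫ x, p x)
      (fun n => Finset.sum_nonneg fun k _ => ha _ _) fun n => ?_
    have : 0 ≤ ∫ x, (R n).1 x := integral_nonneg (R n).2.1
    rw [hRI] at this
    linarith
  have hTc : ∀ i, Continuous (T i) := fun i => continuous_const.mul
    (continuous_finsetProd _ fun j _ => (hGp i j).1.continuous.comp (continuous_apply j))
  have hSle : ∀ x, ∑' i, T i x ≤ p x := by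
    intro x
    rw [hTtsum]
    exact (hssum x).tsum_le_of_sum_range_le fun n => hsle n x
  obtain ⟨e⟩ : Nonempty (ℕ ≃ ℕ × (Fin d → ℤ)) := nonempty_equiv_of_countable
  have heS : ∀ x, HasSum (fun i => T (e i) x) (∑' i, T i x) := fun x =>
    (e.hasSum_iff (f := fun i => T i x)).2 (hTsum x).hasSum
  have hSm : Measurable fun x => ∑' i, T i x := by
    refine measurable_of_tendsto_metrizable
      (f := fun N x => ∑ i ∈ range N, T (e i) x) (fun N => ?_) ?_
    · exact (continuous_finsetSum _ fun i _ => hTc _).measurable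
    · rw [tendsto_pi_nhds]
      exact fun x => (heS x).tendsto_sum_nat
  have hS0 : ∀ x, 0 ≤ ∑' i, T i x := fun x => tsum_nonneg fun i => hT0 i x
  have hDi : Integrable fun x => p x - ∑' i, T i x := by
    refine hpi.mono (hmeas.sub hSm).aestronglyMeasurable (Eventually.of_forall fun x => ?_)
    rw [Real.norm_eq_abs, Real.norm_eq_abs, abs_of_nonneg (hnn x),
      abs_of_nonneg (sub_nonneg.2 (hSle x))]
    linarith [hS0 x]
  have hD0 : ∫ x, (p x - ∑' i, T i x) = 0 := by
    refine le_antisymm ?_ (integral_nonneg fun x => sub_nonneg.2 (hSle x))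
    have hlim : Tendsto (fun n : ℕ => q ^ n * ∫ x, p x) atTop (nhds 0) := by
      simpa using (tendsto_pow_atTop_nhds_zero_of_lt_one hq0 hq1).mul_const (∫ x, p x)
    refine ge_of_tendsto' hlim fun n => ?_
    refine le_trans (integral_mono hDi (R n).2.2.1 fun x => ?_) (hRq n)
    simp only [hR, hTtsum]
    have := (hssum x).sum_le_tsum (range n) (fun m _ => hs0 m x)
    linarith
  have hae : ∀ᵐ x ∂(volume : Measure (Fin d → ℝ)), p x = ∑' i, T i x := by
    have := (integral_eq_zero_iff_of_nonneg (fun x => sub_nonneg.2 (hSle x)) hDi).1 hD0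
    filter_upwards [this] with x hx
    exact sub_eq_zero.1 hx
  refine ⟨fun i => W (e i), fun i => G (e i), fun i => hW0 _, fun i j => hGp _ _,
    (e.summable_iff (f := W)).2 hWsum, ?_, ?_⟩
  · filter_upwards [hae] with x hx
    rw [hx]
    exact (heS x).tsum_eq.symm
  · have h0 : (0:ℝ) = ∫ x : Fin d → ℝ, (0:ℝ) := by simp
    rw [h0]
    refine tendsto_integral_of_dominated_convergence p (fun N => ?_) hpi (fun N => ?_) ?_
    · exact ((hmeas.sub (continuous_finsetSum _ fun i _ => hTc (e i)).measurable).abs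
        ).aestronglyMeasurable
    · refine Eventually.of_forall fun x => ?_
      have h1 : ∑ i ∈ range N, T (e i) x ≤ ∑' i, T i x :=
        sum_le_hasSum _ (fun i _ => hT0 _ _) (heS x)
      have h2 : 0 ≤ ∑ i ∈ range N, T (e i) x := Finset.sum_nonneg fun i _ => hT0 _ _
      have h3 := hSle x
      change ‖|p x - ∑ i ∈ range N, T (e i) x|‖ ≤ p x
      rw [norm_abs_eq_norm, Real.norm_eq_abs, abs_of_nonneg (by linarith)]
      linarith
    · filter_upwards [hae] with x hx
      have := ((heS x).tendsto_sum_nat.const_sub (p x)).abs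
      rw [← hx, sub_self, abs_zero] at this
      exact this
end
end

section
/- Let p ∈ 𝒟_d be a pdf supported on [0,1]^d with NL-spectrum (w, L), and let b, k ∈ ℕ. Then the L¹ approximation error of p by rank-k histograms satisfies: there exists h ∈ ℋ^k_{d,b} with ‖p − h‖_1 ≤ (d/(√12 · b)) ∑_{i=1}^k w_i L_i + 2 ∑_{i=k+1}^∞ w_i. -/
open MeasureTheory Filter Finset

noncomputable section

/-- Membership in `ℋ_{1,b}`: a pdf on `[0,1]` constant on each bin `[(i-1)/b, i/b)`. -/
def IsHist1 (b : ℕ) (h : ℝ → ℝ) : Prop :=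
  ∃ c : Fin b → ℝ, (∀ i, 0 ≤ c i) ∧
    (∀ x, h x = ∑ i : Fin b,
      c i * Set.indicator (Set.Ico ((i.val : ℝ) / b) (((i.val : ℝ) + 1) / b)) 1 x) ∧
    ∫ x, h x = 1

/-- Membership in `ℋ^k_{d,b}`: a convex combination of `k` products of `d` histograms. -/
def IsLowRankHist (d b k : ℕ) (q : (Fin d → ℝ) → ℝ) : Prop :=
  ∃ (w : Fin k → ℝ) (h : Fin k → Fin d → ℝ → ℝ),
    (∀ i, 0 ≤ w i) ∧ (∑ i, w i = 1) ∧ (∀ i j, IsHist1 b (h i j)) ∧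
    ∀ x, q x = ∑ i, w i * ∏ j, h i j (x j)


lemma bin_bound (f : ℝ → ℝ) (L a b A : ℝ) (hab : a < b) (hc : Continuous f)
    (hL : ∀ x y, |f x - f y| ≤ L * |x - y|) (hA : A * (b - a) = ∫ x in a..b, f x) :
    ∫ x in a..b, |f x - A| ≤ L * (b - a) ^ 2 / Real.sqrt 12 := by
  have hL0 : 0 ≤ L := by
    have := (abs_nonneg _).trans (hL 1 0)
    simpa using this
  set m := (a + b) / 2 with hm
  set B := (∫ x in a..b, |f x - A|) with hB
  have hi : ∀ g : ℝ → ℝ, Continuous g → IntervalIntegrable g volume a b :=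
    fun g hg => hg.intervalIntegrable _ _
  have hba : 0 < b - a := sub_pos.2 hab
  -- step 1: variance bound
  have h1 : ∫ x in a..b, (f x - f m) ^ 2 ≤ L ^ 2 * (b - a) ^ 3 / 12 := by
    have : ∫ x in a..b, (f x - f m) ^ 2 ≤ ∫ x in a..b, L ^ 2 * (x - m) ^ 2 := by
      apply intervalIntegral.integral_mono_on hab.le (hi _ (by fun_prop)) (hi _ (by fun_prop))
      intro x _
      rw [← sq_abs (f x - f m), ← sq_abs (x - m), ← mul_pow]
      exact pow_le_pow_left₀ (abs_nonneg _) (hL x m) 2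
    refine this.trans (le_of_eq ?_)
    rw [intervalIntegral.integral_const_mul,
      intervalIntegral.integral_comp_sub_right (fun x => x ^ 2) m, integral_pow, hm]
    norm_num
    ring
  have e1 : ∫ x in a..b, (f x - A) ^ 2 =
      (∫ x in a..b, (f x - f m) ^ 2) - (f m - A) ^ 2 * (b - a) := by
    have : ∀ x, (f x - A) ^ 2 = (f x - f m) ^ 2 + (2 * (f m - A) * f x
        + (A ^ 2 - f m ^ 2 )) := by intro x; ring
    simp_rw [this]
    have e := hi f hc
    rw [intervalIntegral.integral_add (hi _ (by fun_prop)) (hi _ (by fun_prop)),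
      intervalIntegral.integral_add (hi _ (by fun_prop)) (hi _ (by fun_prop)),
      intervalIntegral.integral_const_mul, ← hA, intervalIntegral.integral_const, smul_eq_mul]
    ring
  have h2 : ∫ x in a..b, (f x - A) ^ 2 ≤ L ^ 2 * (b - a) ^ 3 / 12 := by
    rw [e1]; nlinarith [mul_nonneg (sq_nonneg (f m - A)) hba.le]
  -- Cauchy-Schwarz
  have h3 : B ^ 2 ≤ (b - a) * ∫ x in a..b, (f x - A) ^ 2 := by
    have h0 : 0 ≤ ∫ x in a..b, ((b - a) * |f x - A| - B) ^ 2 :=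
      intervalIntegral.integral_nonneg hab.le (fun x _ => sq_nonneg _)
    have : ∀ x, ((b - a) * |f x - A| - B) ^ 2 = (b - a) ^ 2 * (f x - A) ^ 2
        + (- 2 * (b - a) * B * |f x - A| + B ^ 2) := by
      intro x; rw [← sq_abs (f x - A)]; ring
    simp_rw [this] at h0
    rw [intervalIntegral.integral_add (hi _ (by fun_prop)) (hi _ (by fun_prop)),
      intervalIntegral.integral_add (hi _ (by fun_prop)) (hi _ (by fun_prop)),
      intervalIntegral.integral_const_mul, intervalIntegral.integral_const_mul,
      ← hB, intervalIntegral.integral_const, smul_eq_mul] at h0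
    have : 0 ≤ (b - a) * ((b - a) * (∫ x in a..b, (f x - A) ^ 2) - B ^ 2) := by
      linarith
    have := nonneg_of_mul_nonneg_right this hba
    linarith
  refine (le_abs_self B).trans (abs_le_of_sq_le_sq ?_ ?_)
  · rw [div_pow, Real.sq_sqrt (by norm_num)]
    calc B ^ 2 ≤ _ := h3
      _ ≤ (b - a) * (L ^ 2 * (b - a) ^ 3 / 12) := by gcongr
      _ = _ := by ring
  · positivity

/-- telescoping bound for products -/
lemma prod_bound {d : ℕ} (q h : Fin d → ℝ → ℝ)
    (hq : ∀ j, Integrable (q j)) (hh : ∀ j, Integrable (h j))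
    (hq0 : ∀ j x, 0 ≤ q j x) (hh0 : ∀ j x, 0 ≤ h j x)
    (hq1 : ∀ j, ∫ x, q j x = 1) (hh1 : ∀ j, ∫ x, h j x = 1) :
    ∫ x : Fin d → ℝ, |∏ j, q j (x j) - ∏ j, h j (x j)| ≤ ∑ j, ∫ x, |q j x - h j x| := by
  let F : Fin d → Fin d → ℝ → ℝ := fun j l x =>
    if l < j then q l x else if l = j then |q l x - h l x| else h l x
  have hF : ∀ j l, Integrable (F j l) := by
    intro j l
    rcases lt_trichotomy l j with hl | hl | hl
    · simp only [F, hl, if_true]; exact hq l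
    · subst hl; simp only [F, lt_irrefl, if_true, if_false]; exact ((hq l).sub (hh l)).abs
    · simp only [F, hl.not_gt, hl.ne', if_false]; exact hh l
  have hFi : ∀ j, ∫ x : Fin d → ℝ, ∏ l, F j l (x l) = ∫ x, |q j x - h j x| := by
    intro j
    rw [integral_fintype_prod_volume_eq_prod]
    rw [Finset.prod_eq_single j]
    · simp [F]
    · intro l _ hl
      rcases lt_or_gt_of_ne hl with hl | hl
      · simp only [F, hl, if_true, hq1]
      · simp only [F, hl.not_gt, hl.ne', if_false, hh1]
    · simp
  simp_rw [← hFi]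
  have hFint : ∀ j, Integrable (fun x : Fin d → ℝ => ∏ l, F j l (x l)) volume :=
    fun j => Integrable.fintype_prod (fun l => hF j l)
  rw [← integral_finsetSum _ (fun j _ => hFint j)]
  apply integral_mono_of_nonneg (Eventually.of_forall fun x => abs_nonneg _)
  · exact integrable_finsetSum _ (fun j _ => hFint j)
  refine Eventually.of_forall fun x => ?_
  have key := Finset.prod_add_ordered (Finset.univ : Finset (Fin d)) (fun j => h j (x j))
    (fun j => q j (x j) - h j (x j))
  simp only [add_sub_cancel] at key
  simp only
  rw [key, add_sub_cancel_left]
  refine (Finset.abs_sum_le_sum_abs _ _).trans (Finset.sum_le_sum fun j _ => le_of_eq ?_)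
  rw [abs_mul, abs_mul, abs_of_nonneg (Finset.prod_nonneg fun l _ => hq0 _ _),
    abs_of_nonneg (Finset.prod_nonneg fun l _ => hh0 _ _)]
  rw [← Finset.mul_prod_erase Finset.univ _ (Finset.mem_univ j), mul_assoc]
  congr 1
  · simp [F]
  · rw [← Finset.prod_filter_mul_prod_filter_not (Finset.univ.erase j) (fun l => l < j)]
    congr 1
    · apply Finset.prod_congr
      · ext l; simp only [mem_filter, mem_univ, mem_erase, true_and]; grind
      · intro l hl; simp at hl; simp [F, hl]
    · apply Finset.prod_congr
      · ext l; simp only [mem_filter, mem_univ, mem_erase, true_and]; grind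
      · intro l hl; simp at hl; simp [F, hl.2, hl.1]

lemma part_unity (b : ℕ) (hb : 1 ≤ b) (x : ℝ) (hx : x ∈ Set.Ico (0 : ℝ) 1) :
    ∑ i : Fin b, Set.indicator (Set.Ico ((i.val : ℝ) / b) (((i.val : ℝ) + 1) / b))
      (1 : ℝ → ℝ) x = 1 := by
  have hb0 : (0 : ℝ) < b := by exact_mod_cast hb
  have hxb : 0 ≤ x * b := mul_nonneg hx.1 hb0.le
  have hlt : ⌊x * b⌋₊ < b := by
    rw [Nat.floor_lt hxb]; nlinarith [hx.2]
  have hiff : ∀ i : Fin b, x ∈ Set.Ico ((i.val : ℝ) / b) (((i.val : ℝ) + 1) / b) ↔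
      i = ⟨⌊x * b⌋₊, hlt⟩ := by
    intro i
    rw [Set.mem_Ico, div_le_iff₀ hb0, lt_div_iff₀ hb0, ← Nat.floor_eq_iff hxb, Fin.ext_iff]
    exact eq_comm
  simp only [Set.indicator_apply, hiff]
  simp

lemma part_zero (b : ℕ) (hb : 1 ≤ b) (x : ℝ) (hx : x ∉ Set.Ico (0 : ℝ) 1) (i : Fin b) :
    x ∉ Set.Ico ((i.val : ℝ) / b) (((i.val : ℝ) + 1) / b) := by
  have hb0 : (0 : ℝ) < b := by exact_mod_cast hb
  intro h
  apply hx
  refine ⟨le_trans (by positivity) h.1, lt_of_lt_of_le h.2 ?_⟩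
  rw [div_le_one hb0]
  exact_mod_cast i.2

lemma part_fun (b : ℕ) (hb : 1 ≤ b) (q : ℝ → ℝ) (hq : ∀ x, x ∉ Set.Ico (0 : ℝ) 1 → q x = 0)
    (x : ℝ) : ∑ i : Fin b, Set.indicator (Set.Ico ((i.val : ℝ) / b) (((i.val : ℝ) + 1) / b))
      q x = q x := by
  by_cases hx : x ∈ Set.Ico (0 : ℝ) 1
  · have : ∀ i : Fin b, Set.indicator (Set.Ico ((i.val : ℝ) / b) (((i.val : ℝ) + 1) / b)) q x
      = q x * Set.indicator (Set.Ico ((i.val : ℝ) / b) (((i.val : ℝ) + 1) / b))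
        (1 : ℝ → ℝ) x := by
      intro i; simp [Set.indicator_apply]
    simp_rw [this]
    rw [← Finset.mul_sum, part_unity b hb x hx, mul_one]
  · rw [hq x hx]
    exact Finset.sum_eq_zero fun i _ => by
      simp [Set.indicator_of_notMem (part_zero b hb x hx i)]

def histOf (b : ℕ) (q : ℝ → ℝ) : ℝ → ℝ := fun x => ∑ i : Fin b,
  (b * ∫ y in Set.Ico ((i.val : ℝ) / b) (((i.val : ℝ) + 1) / b), q y) *
    Set.indicator (Set.Ico ((i.val : ℝ) / b) (((i.val : ℝ) + 1) / b)) 1 x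

lemma hist_of (b : ℕ) (hb : 1 ≤ b) (q : ℝ → ℝ) (hi : Integrable q) (h0 : ∀ x, 0 ≤ q x)
    (h1 : ∫ x, q x = 1) (hq : ∀ x, x ∉ Set.Ico (0 : ℝ) 1 → q x = 0) :
    IsHist1 b (histOf b q) := by
  have hb0 : (0 : ℝ) < b := by exact_mod_cast hb
  refine ⟨fun i => b * ∫ y in Set.Ico ((i.val : ℝ) / b) (((i.val : ℝ) + 1) / b), q y,
    fun i => mul_nonneg hb0.le (integral_nonneg h0), fun x => rfl, ?_⟩
  unfold histOf
  rw [integral_finsetSum]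
  · refine Eq.trans ?_ h1
    have : ∀ x, q x = _ := fun x => (part_fun b hb q hq x).symm
    conv_rhs => rw [integral_congr_ae (Eventually.of_forall this)]
    rw [integral_finsetSum _ (fun i _ => hi.indicator measurableSet_Ico)]
    refine Finset.sum_congr rfl fun i _ => ?_
    rw [integral_const_mul, integral_indicator measurableSet_Ico,
      integral_indicator measurableSet_Ico]
    have : ((i.val : ℝ) + 1) / b - i.val / b = 1 / b := by ring
    have e : ∫ x in Set.Ico ((i.val : ℝ) / b) (((i.val : ℝ) + 1) / b), (1 : ℝ → ℝ) x
        = 1 / b := by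
      simp only [Pi.one_apply]
      rw [setIntegral_const, Real.volume_real_Ico, this, smul_eq_mul, mul_one,
        max_eq_left (by positivity)]
    rw [e]
    field_simp
  · intro i _
    refine Integrable.const_mul ?_ _
    rw [integrable_indicator_iff measurableSet_Ico]
    exact integrableOn_const (by simp)

lemma hist_dist (b : ℕ) (hb : 1 ≤ b) (q : ℝ → ℝ) (L : ℝ)
    (hL : ∀ x y, |q x - q y| ≤ L * |x - y|) (hc : Continuous q)
    (hq : ∀ x, x ∉ Set.Ico (0 : ℝ) 1 → q x = 0) :
    ∫ x, |q x - histOf b q x| ≤ L / (Real.sqrt 12 * b) := by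
  have hb0 : (0 : ℝ) < b := by exact_mod_cast hb
  let I : Fin b → Set ℝ := fun i => Set.Ico ((i.val : ℝ) / b) (((i.val : ℝ) + 1) / b)
  let c : Fin b → ℝ := fun i => b * ∫ y in I i, q y
  have hint : ∀ i ∈ (Finset.univ : Finset (Fin b)),
      Integrable (fun x => (I i).indicator (fun x => |q x - c i|) x) := by
    intro i _
    refine IntegrableOn.integrable_indicator ?_ measurableSet_Ico
    exact ((hc.sub continuous_const).abs.continuousOn.integrableOn_Icc).mono_set
      Set.Ico_subset_Icc_self
  have hlt : ∀ i : Fin b, (i.val : ℝ) / b < ((i.val : ℝ) + 1) / b := by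
    intro i; gcongr; linarith
  have hlen : ∀ i : Fin b, ((i.val : ℝ) + 1) / b - i.val / b = 1 / b := by intro i; ring
  calc ∫ x, |q x - histOf b q x|
      ≤ ∫ x, ∑ i, (I i).indicator (fun x => |q x - c i|) x := by
        apply integral_mono_of_nonneg (Eventually.of_forall fun x => abs_nonneg _)
          (integrable_finsetSum _ hint)
        refine Eventually.of_forall fun x => ?_
        simp only
        conv_lhs => rw [← part_fun b hb q hq x]
        unfold histOf
        rw [← Finset.sum_sub_distrib]
        refine (Finset.abs_sum_le_sum_abs _ _).trans (Finset.sum_le_sum fun i _ => ?_)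
        by_cases hx : x ∈ I i
        · simp only [Set.indicator_of_mem hx]
          simp [Set.indicator_of_mem hx, I, c] at hx ⊢
        · have hx' : x ∉ Set.Ico ((i.val : ℝ) / b) (((i.val : ℝ) + 1) / b) := hx
          rw [Set.indicator_of_notMem hx, Set.indicator_of_notMem hx',
            Set.indicator_of_notMem hx']
          simp
    _ = ∑ i, ∫ x, (I i).indicator (fun x => |q x - c i|) x := integral_finsetSum _ hint
    _ ≤ ∑ i : Fin b, L * (1 / b) ^ 2 / Real.sqrt 12 := by
        refine Finset.sum_le_sum fun i _ => ?_
        rw [integral_indicator measurableSet_Ico, integral_Ico_eq_integral_Ioc,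
          ← intervalIntegral.integral_of_le (hlt i).le, ← hlen i]
        apply bin_bound q L _ _ _ (hlt i) hc hL
        rw [hlen, intervalIntegral.integral_of_le (hlt i).le, ← integral_Ico_eq_integral_Ioc]
        simp only [c, I]
        field_simp
    _ = L / (Real.sqrt 12 * b) := by
        simp
        field_simp

lemma hist_integrable {b : ℕ} {h : ℝ → ℝ} (hh : IsHist1 b h) : Integrable h := by
  obtain ⟨c, _, _, h1⟩ := hh
  by_contra hn
  rw [integral_undef hn] at h1
  norm_num at h1

lemma hist_nonneg {b : ℕ} {h : ℝ → ℝ} (hh : IsHist1 b h) (x : ℝ) : 0 ≤ h x := by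
  obtain ⟨c, hc, he, _⟩ := hh
  rw [he]
  exact Finset.sum_nonneg fun i _ => mul_nonneg (hc i)
    (Set.indicator_nonneg (fun _ _ => zero_le_one) _)

lemma exists_hist (b : ℕ) (hb : 1 ≤ b) : ∃ h, IsHist1 b h := by
  refine ⟨_, hist_of b hb ((Set.Ico (0 : ℝ) 1).indicator 1) ?_ ?_ ?_ ?_⟩
  · rw [integrable_indicator_iff measurableSet_Ico]
    exact integrableOn_const (by simp)
  · exact fun x => Set.indicator_nonneg (fun _ _ => zero_le_one) _
  · rw [integral_indicator measurableSet_Ico]; simp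
  · exact fun x hx => Set.indicator_of_notMem hx _

lemma integrable_of_one {α : Type*} [MeasurableSpace α] {μ : Measure α} {f : α → ℝ}
    (h1 : ∫ x, f x ∂μ = 1) : Integrable f μ := by
  by_contra hn
  rw [integral_undef hn] at h1
  norm_num at h1

lemma ae_summable_of {α : Type*} [MeasurableSpace α] {μ : Measure α} (F : ℕ → α → ℝ)
    (w : ℕ → ℝ) (hF : ∀ i, Integrable (F i) μ) (h0 : ∀ i x, 0 ≤ F i x)
    (hw : Summable w) (hw' : ∀ i, ∫ x, F i x ∂μ = w i) :
    ∀ᵐ x ∂μ, Summable fun i => F i x := by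
  have hw0 : ∀ i, 0 ≤ w i := fun i => by rw [← hw' i]; exact integral_nonneg (h0 i)
  have hfin : ∫⁻ x, ∑' i, ENNReal.ofReal (F i x) ∂μ ≠ ⊤ := by
    rw [lintegral_tsum (fun i => (hF i).aemeasurable.ennreal_ofReal)]
    have : ∀ i, ∫⁻ x, ENNReal.ofReal (F i x) ∂μ = ENNReal.ofReal (w i) := by
      intro i
      rw [← hw' i, ofReal_integral_eq_lintegral_ofReal (hF i) (Eventually.of_forall (h0 i))]
    simp_rw [this]
    rw [← ENNReal.ofReal_tsum_of_nonneg hw0 hw]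
    exact ENNReal.ofReal_ne_top
  have hae := ae_lt_top' (AEMeasurable.ennreal_tsum
    fun i => (hF i).aemeasurable.ennreal_ofReal) hfin
  filter_upwards [hae] with x hx
  have := ENNReal.summable_toReal hx.ne
  simpa [ENNReal.toReal_ofReal, h0] using this

lemma supp_lemma (d : ℕ) (q : Fin d → ℝ → ℝ) (hc : ∀ j, Continuous (q j))
    (h1 : ∀ j, ∫ x, q j x = 1)
    (hz : ∀ᵐ x : Fin d → ℝ, x ∉ Set.Icc (0 : Fin d → ℝ) 1 → ∏ j, q j (x j) = 0)
    (j : Fin d) (t : ℝ) (ht : t ∉ Set.Ico (0 : ℝ) 1) : q j t = 0 := by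
  have hU : IsOpen (Set.Icc (0 : Fin d → ℝ) 1)ᶜ := isClosed_Icc.isOpen_compl
  have hEq : Set.EqOn (fun x : Fin d → ℝ => ∏ j, q j (x j)) (fun _ => 0)
      (Set.Icc (0 : Fin d → ℝ) 1)ᶜ := by
    refine Measure.eqOn_open_of_ae_eq (μ := volume) ?_ hU ?_ continuousOn_const
    · exact (ae_restrict_iff' hU.measurableSet).2 hz
    · exact Continuous.continuousOn (continuous_finset_prod _ fun j _ =>
        (hc j).comp (continuous_apply j))
  have hne : ∀ l, ∃ y, q l y ≠ 0 := by
    intro l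
    by_contra! hn
    have := h1 l
    simp [hn] at this
  choose y hy using hne
  have hout : ∀ s, s ∉ Set.Icc (0 : ℝ) 1 → q j s = 0 := by
    intro s hs
    have hx : Function.update y j s ∈ (Set.Icc (0 : Fin d → ℝ) 1)ᶜ := by
      intro hmem
      apply hs
      have a := hmem.1 j
      have b := hmem.2 j
      simp at a b
      exact ⟨a, b⟩
    have := hEq hx
    simp only [Finset.prod_eq_zero_iff] at this
    obtain ⟨l, _, hl⟩ := this
    by_cases hlj : l = j
    · subst hlj; simpa using hl
    · rw [Function.update_of_ne hlj] at hl
      exact absurd hl (hy l)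
  by_cases ht1 : t = 1
  · subst ht1
    have hcl : IsClosed {s | q j s = 0} := isClosed_eq (hc j) continuous_const
    have hsub : Set.Ioi (1 : ℝ) ⊆ {s | q j s = 0} := fun s hs =>
      hout s (fun h => absurd h.2 (not_le.2 hs))
    have := closure_minimal hsub hcl
    rw [closure_Ioi] at this
    exact this (Set.mem_Ici.2 le_rfl)
  · apply hout
    intro h
    exact ht ⟨h.1, lt_of_le_of_ne h.2 ht1⟩

/-- **Lemma 10.** Bias bound in terms of the NL-spectrum.  The paper's `k ∈ ℕ = {1,2,...}`
is represented as `k+1` with `k : ℕ`; by the `0`-indexing convention, the paper's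
`∑_{i=1}^k w_i L_i` is `∑ i ∈ range (k+1), w i * L i` and `∑_{i=k+1}^∞ w_i` is
`∑' i, w (i + (k+1))`. -/
theorem nl_spectrum_bias_bound
    (d b k : ℕ) (hd : 1 ≤ d) (hb : 1 ≤ b)
    (p : (Fin d → ℝ) → ℝ) (w L : ℕ → ℝ)
    (hp : MemD d p) (hspec : HasNLSpectrum d p w L) :
    ∃ h : (Fin d → ℝ) → ℝ, IsLowRankHist d b (k + 1) h ∧
      ∫ x, |p x - h x|
        ≤ (d : ℝ) / (Real.sqrt 12 * b) * ∑ i ∈ range (k + 1), w i * L i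
          + 2 * ∑' i, w (i + (k + 1)) := by
  obtain ⟨q, hw0, hw00, hws, hq, hpq⟩ := hspec
  obtain ⟨hpm, hp0, hp1, hpz⟩ := hp
  have hqc : ∀ i j, Continuous (q i j) := by
    intro i j
    have hl := (hq i j).2
    have : LipschitzWith (Real.toNNReal (L i)) (q i j) := by
      apply LipschitzWith.of_dist_le_mul
      intro x y
      rw [Real.dist_eq, Real.dist_eq]
      refine (hl x y).trans ?_
      gcongr
      exact Real.le_coe_toNNReal _
    exact this.continuous
  have hq0 : ∀ i j x, 0 ≤ q i j x := by
    intro i j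
    have hae := (hq i j).1.2.1
    have : (fun x => max (q i j x) 0) = q i j := by
      refine Continuous.ae_eq_iff_eq (volume : Measure ℝ)
        ((hqc i j).max continuous_const) (hqc i j) |>.1 ?_
      filter_upwards [hae] with x hx
      exact max_eq_left hx
    intro x
    rw [← this]
    exact le_max_right _ _
  have hq1 : ∀ i j, ∫ x, q i j x = 1 := fun i j => (hq i j).1.2.2
  have hqi : ∀ i j, Integrable (q i j) := fun i j => integrable_of_one (hq1 i j)
  let Q : ℕ → (Fin d → ℝ) → ℝ := fun i x => ∏ j, q i j (x j)
  have hQ1 : ∀ i, ∫ x, Q i x = 1 := by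
    intro i
    simp only [Q]
    rw [integral_fintype_prod_volume_eq_prod]
    simp [hq1]
  have hQi : ∀ i, Integrable (Q i) := fun i => integrable_of_one (hQ1 i)
  have hQ0 : ∀ i x, 0 ≤ Q i x := fun i x => Finset.prod_nonneg fun j _ => hq0 i j _
  have hsum : ∀ᵐ x : Fin d → ℝ, Summable fun i => w i * Q i x := by
    refine ae_summable_of (fun i x => w i * Q i x) w (fun i => (hQi i).const_mul _)
      (fun i x => mul_nonneg (hw0 i) (hQ0 i x)) hws.summable (fun i => ?_)
    rw [integral_const_mul, hQ1, mul_one]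
  have hle : ∀ᵐ x : Fin d → ℝ, ∀ s : Finset ℕ, ∑ i ∈ s, w i * Q i x ≤ p x := by
    filter_upwards [hsum, hpq] with x hx hpx s
    rw [hpx]
    exact hx.sum_le_tsum s (fun i _ => mul_nonneg (hw0 i) (hQ0 i x))
  have hz : ∀ i, w i ≠ 0 → ∀ j t, t ∉ Set.Ico (0 : ℝ) 1 → q i j t = 0 := by
    intro i hi
    refine supp_lemma d (q i) (hqc i) (hq1 i) ?_
    filter_upwards [hle] with x hx hxn
    have h := hx {i}
    rw [hpz x hxn, Finset.sum_singleton] at h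
    have hwi : 0 < w i := lt_of_le_of_ne (hw0 i) (Ne.symm hi)
    have := hQ0 i x
    change Q i x = 0
    nlinarith
  have hex : ∀ i j, ∃ h, IsHist1 b h ∧
      (w i ≠ 0 → ∫ x, |q i j x - h x| ≤ L i / (Real.sqrt 12 * b)) := by
    intro i j
    by_cases hi : w i = 0
    · obtain ⟨h, hh⟩ := exists_hist b hb
      exact ⟨h, hh, fun hn => absurd hi hn⟩
    · exact ⟨histOf b (q i j), hist_of b hb _ (hqi i j) (hq0 i j) (hq1 i j) (hz i hi j),
        fun _ => hist_dist b hb _ _ (hq i j).2 (hqc i j) (hz i hi j)⟩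
  choose h hh hhd using hex
  let H : ℕ → (Fin d → ℝ) → ℝ := fun i x => ∏ j, h i j (x j)
  have hh1 : ∀ i j, ∫ x, h i j x = 1 := fun i j => (hh i j).choose_spec.2.2
  have hH1 : ∀ i, ∫ x, H i x = 1 := by
    intro i
    simp only [H]
    rw [integral_fintype_prod_volume_eq_prod]
    simp [hh1]
  have hHi : ∀ i, Integrable (H i) := fun i => integrable_of_one (hH1 i)
  have hH0 : ∀ i x, 0 ≤ H i x := fun i x =>
    Finset.prod_nonneg fun j _ => hist_nonneg (hh i j) _
  have hdist : ∀ i, w i * ∫ x, |Q i x - H i x| ≤ w i * (d * (L i / (Real.sqrt 12 * b))) := by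
    intro i
    by_cases hi : w i = 0
    · simp [hi]
    · refine mul_le_mul_of_nonneg_left ?_ (hw0 i)
      refine (prod_bound (q i) (h i) (hqi i) (fun j => hist_integrable (hh i j)) (hq0 i)
        (fun j => hist_nonneg (hh i j)) (hq1 i) (hh1 i)).trans ?_
      refine (Finset.sum_le_sum fun j _ => hhd i j hi).trans ?_
      simp
  set T := ∑' i, w (i + (k + 1)) with hT
  have hT0 : 0 ≤ T := tsum_nonneg fun i => hw0 _
  have hTs : ∑ i ∈ range (k + 1), w i + T = 1 := by
    rw [hT, hws.summable.sum_add_tsum_nat_add, hws.tsum_eq]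
  let v : ℕ → ℝ := fun i => w i + if i = 0 then T else 0
  have hvs : ∀ f : ℕ → ℝ, ∑ i ∈ range (k + 1), v i * f i =
      ∑ i ∈ range (k + 1), w i * f i + T * f 0 := by
    intro f
    simp only [v, add_mul, Finset.sum_add_distrib, ite_mul, zero_mul]
    simp
  refine ⟨fun x => ∑ i ∈ range (k + 1), v i * H i x,
    ⟨fun i => v i, fun i => h i, ?_, ?_, fun i j => hh i j, ?_⟩, ?_⟩
  · intro i
    have := hw0 i
    simp only [v]
    split_ifs <;> linarith
  · rw [Fin.sum_univ_eq_sum_range (fun i => v i)]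
    have := hvs (fun _ => 1)
    simp only [mul_one] at this
    rw [this, hTs]
  · intro x
    rw [Fin.sum_univ_eq_sum_range (fun i => v i * ∏ j, h i j (x j))]
  have i1 : Integrable (fun x => ∑ i ∈ range (k + 1), w i * |Q i x - H i x|) :=
    integrable_finsetSum _ fun i _ => ((hQi i).sub (hHi i)).abs.const_mul _
  have i2 : Integrable (fun x => T * H 0 x) := (hHi 0).const_mul _
  have i3 : Integrable (fun x => ∑ i ∈ range (k + 1), w i * Q i x) :=
    integrable_finsetSum _ fun i _ => (hQi i).const_mul _
  have ip : Integrable p := integrable_of_one hp1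
  have i12 : Integrable (fun x => ∑ i ∈ range (k + 1), w i * |Q i x - H i x| + T * H 0 x) :=
    i1.add i2
  have i4 : Integrable (fun x => p x - ∑ i ∈ range (k + 1), w i * Q i x) := ip.sub i3
  calc ∫ x, |p x - ∑ i ∈ range (k + 1), v i * H i x|
      ≤ ∫ x, ((∑ i ∈ range (k + 1), w i * |Q i x - H i x| + T * H 0 x)
          + (p x - ∑ i ∈ range (k + 1), w i * Q i x)) := by
        apply integral_mono_of_nonneg (Eventually.of_forall fun x => abs_nonneg _) (i12.add i4)
        filter_upwards [hle] with x hx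
        have hx := hx (range (k + 1))
        rw [hvs (fun i => H i x)]
        have e : p x - (∑ i ∈ range (k + 1), w i * H i x + T * H 0 x) =
          (∑ i ∈ range (k + 1), w i * (Q i x - H i x)) + (- (T * H 0 x))
            + (p x - ∑ i ∈ range (k + 1), w i * Q i x) := by
          simp only [mul_sub, Finset.sum_sub_distrib]; ring
        rw [e]
        refine (abs_add_three _ _ _).trans ?_
        rw [abs_neg, abs_of_nonneg (mul_nonneg hT0 (hH0 0 x)), abs_of_nonneg (sub_nonneg.2 hx)]
        refine add_le_add (add_le_add ?_ le_rfl) le_rfl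
        refine (Finset.abs_sum_le_sum_abs _ _).trans (le_of_eq ?_)
        refine Finset.sum_congr rfl fun i _ => ?_
        rw [abs_mul, abs_of_nonneg (hw0 i)]
    _ = ∑ i ∈ range (k + 1), w i * (∫ x, |Q i x - H i x|) + T
          + (1 - ∑ i ∈ range (k + 1), w i) := by
        rw [integral_add i12 i4, integral_add i1 i2, integral_sub ip i3, hp1,
          integral_const_mul, hH1, mul_one,
          integral_finsetSum (f := fun i x => w i * |Q i x - H i x|) _
            fun i _ => ((hQi i).sub (hHi i)).abs.const_mul _,
          integral_finsetSum _ fun i _ => (hQi i).const_mul _]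
        simp only [integral_const_mul, hQ1, mul_one]
    _ ≤ ∑ i ∈ range (k + 1), w i * (d * (L i / (Real.sqrt 12 * b))) + T + T := by
        refine add_le_add (add_le_add (Finset.sum_le_sum fun i _ => hdist i) le_rfl) ?_
        linarith
    _ = _ := by
        rw [Finset.mul_sum, two_mul, ← add_assoc]
        congr 2
        refine Finset.sum_congr rfl fun i _ => ?_
        ring
end
end
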